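/- arXiv:1606.02431 — 10 statements merged into one kernel-verified Lean document; each statement's English description precedes it below -/
import Mathlib

section
/- Let G be a finite group with exactly 3 cyclic subgroups. Then G is isomorphic to the cyclic group C_{p^2} for some prime p. -/
theorem Subgroup.eq_top_or_eq_top_of_forall_mem_or_mem {G : Type*} [Group G] {A B : Subgroup G}
    (h : ∀ a, a ∈ A ∨ a ∈ B) : A = ⊤ ∨ B = ⊤ := by
  simp only [Subgroup.eq_top_iff']
  by_contra! hne
  obtain ⟨⟨a, ha⟩, b, hb⟩ := hne
  have haB := (h a).resolve_left ha
  have hbA := (h b).resolve_right hb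
  rcases h (a * b) with hab | hab
  · exact ha ((A.mul_mem_cancel_right hbA).1 hab)
  · exact hb ((B.mul_mem_cancel_left haB).1 hab)

theorem isCyclic_of_ncard_isCyclic_subgroup_eq_three {G : Type*} [Group G] [Finite G]
    (h : {H : Subgroup G | IsCyclic H}.ncard = 3) : IsCyclic G := by
  have hbot : (⊥ : Subgroup G) ∈ {H : Subgroup G | IsCyclic H} := Bot.isCyclic
  have htwo : ({H : Subgroup G | IsCyclic H} \ {⊥}).ncard = 2 := by
    rw [Set.ncard_sdiff_singleton_of_mem hbot, h]
  obtain ⟨A, B, -, hAB⟩ := Set.ncard_eq_two.1 htwo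
  have hA : IsCyclic A := (hAB.symm.subset (Set.mem_insert A {B})).1
  have hB : IsCyclic B := (hAB.symm.subset (Set.mem_insert_of_mem A rfl)).1
  have hcover : ∀ a, a ∈ A ∨ a ∈ B := fun a ↦ by
    by_cases ha : a = 1
    · exact .inl (ha ▸ A.one_mem)
    · have hmem : Subgroup.zpowers a ∈ ({A, B} : Set (Subgroup G)) :=
        hAB.subset ⟨inferInstanceAs (IsCyclic (Subgroup.zpowers a)), by simpa using ha⟩
      rcases hmem with hz | hz
      · exact .inl (hz ▸ Subgroup.mem_zpowers a)
      · exact .inr (hz ▸ Subgroup.mem_zpowers a)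
  rcases Subgroup.eq_top_or_eq_top_of_forall_mem_or_mem hcover with rfl | rfl
  · exact Subgroup.topEquiv.isCyclic.1 hA
  · exact Subgroup.topEquiv.isCyclic.1 hB

theorem IsCyclic.exists_subgroup_card_eq {G : Type*} [Group G] [Finite G] [IsCyclic G] {d : ℕ}
    (hd : d ∣ Nat.card G) : ∃ H : Subgroup G, Nat.card H = d := by
  obtain ⟨g, hg⟩ := IsCyclic.exists_ofOrder_eq_natCard (α := G)
  obtain ⟨m, hm⟩ := hd
  have hpos : 0 < m := Nat.pos_of_ne_zero fun h0 ↦ Nat.card_pos.ne' (by rw [hm, h0, mul_zero])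
  refine ⟨Subgroup.zpowers (g ^ m), ?_⟩
  rw [Nat.card_zpowers, orderOf_pow_of_dvd hpos.ne' (hg ▸ hm ▸ dvd_mul_left m d), hg, hm,
    Nat.mul_div_cancel d hpos]

theorem IsCyclic.card_divisors_le_card_subgroup {G : Type*} [Group G] [Finite G] [IsCyclic G] :
    (Nat.card G).divisors.card ≤ Nat.card (Subgroup G) := by
  rw [← Set.ncard_coe_finset, ← Set.ncard_univ (Subgroup G)]
  refine le_trans (Set.ncard_le_ncard ?_ (Set.toFinite _))
    (Set.ncard_image_le (f := fun H : Subgroup G ↦ Nat.card H) (Set.toFinite _))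
  intro d hd
  obtain ⟨H, hH⟩ := IsCyclic.exists_subgroup_card_eq (Nat.dvd_of_mem_divisors hd)
  exact ⟨H, trivial, hH⟩

theorem Nat.eq_one_or_prime_or_exists_prime_sq_of_card_divisors_le_three {n : ℕ} (hn : n ≠ 0)
    (h : n.divisors.card ≤ 3) : n = 1 ∨ n.Prime ∨ ∃ p : ℕ, p.Prime ∧ n = p ^ 2 := by
  by_contra! hne
  obtain ⟨h1, hnp, hsq⟩ := hne
  have hp := Nat.minFac_prime h1
  obtain ⟨m, hm⟩ := Nat.minFac_dvd n
  set p := n.minFac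
  have hpm : p ≠ m := fun he ↦ hsq p hp (by rw [sq]; nth_rw 2 [he]; exact hm)
  have hm1 : m ≠ 1 := fun he ↦ hnp (by rw [hm, he, mul_one]; exact hp)
  have hm0 : m ≠ 0 := fun he ↦ hn (by rw [hm, he, mul_zero])
  have hsub : ({1, p, m, n} : Finset ℕ) ⊆ n.divisors := by
    intro d hd
    simp only [Finset.mem_insert, Finset.mem_singleton] at hd
    rw [Nat.mem_divisors]
    refine ⟨?_, hn⟩
    rcases hd with rfl | rfl | rfl | rfl
    · exact one_dvd n
    · exact Nat.minFac_dvd n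
    · exact Dvd.intro_left p hm.symm
    · exact dvd_rfl
  have hpn : p ≠ n := fun he ↦ hnp (he ▸ hp)
  have hmn : m ≠ n := fun he ↦ by
    have := hp.two_le
    have : 2 * m ≤ p * m := Nat.mul_le_mul_right m this
    omega
  have hcard : ({1, p, m, n} : Finset ℕ).card = 4 := by
    grind [hp.ne_one]
  have := Finset.card_le_card hsub
  omega

theorem card_subgroup_le_two_of_prime_card {G : Type*} [Group G] [Finite G]
    (hp : (Nat.card G).Prime) : Nat.card (Subgroup G) ≤ 2 := by
  have := Fact.mk hp
  rw [← Set.ncard_univ]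
  refine (Set.ncard_le_ncard (t := {⊥, ⊤}) fun H _ ↦ ?_).trans ((Set.ncard_insert_le _ _).trans (by simp))
  exact H.eq_bot_or_eq_top_of_prime_card

theorem stmt_0 {G : Type*} [Group G] [Finite G]
    (h : Nat.card {H : Subgroup G // IsCyclic H} = 3) :
    ∃ p : ℕ, p.Prime ∧ Nonempty (G ≃* Multiplicative (ZMod (p ^ 2))) := by
  have hG : IsCyclic G := isCyclic_of_ncard_isCyclic_subgroup_eq_three h
  have hcard : Nat.card (Subgroup G) = 3 :=
    (Nat.card_congr (Equiv.subtypeUnivEquiv fun H : Subgroup G ↦ H.isCyclic)).symm.trans h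
  rcases Nat.eq_one_or_prime_or_exists_prime_sq_of_card_divisors_le_three Nat.card_pos.ne'
    (hcard ▸ IsCyclic.card_divisors_le_card_subgroup (G := G)) with h1 | hp | ⟨p, hp, hsq⟩
  · have := (Nat.card_eq_one_iff_unique.1 h1).1
    have : Nat.card (Subgroup G) = 1 := Nat.card_unique
    omega
  · have := card_subgroup_le_two_of_prime_card hp
    omega
  · exact ⟨p, hp, ⟨mulEquivOfCyclicCardEq (hsq.trans (Nat.card_zmod _).symm)⟩⟩
end

section
/- Let G be a finite group with exactly 5 cyclic subgroups. Then G is isomorphic to the symmetric group S_3, to C_{p^4} for some prime p, to C_3 × C_3, or to the quaternion group Q_8. -/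
theorem Nat.exists_prime_pow_of_card_divisors_eq_five {n : ℕ} (h : n.divisors.card = 5) :
    ∃ p : ℕ, p.Prime ∧ n = p ^ 4 := by
  have hn0 : n ≠ 0 := by rintro rfl; simp at h
  have hn1 : n ≠ 1 := by rintro rfl; simp at h
  obtain ⟨p, hp, hpn⟩ := Nat.exists_prime_and_dvd hn1
  obtain ⟨k, m, hm, rfl⟩ := Nat.exists_eq_pow_mul_and_not_dvd hn0 p hp.ne_one
  have hc : (p ^ k).Coprime m := ((Nat.Prime.coprime_iff_not_dvd hp).2 hm).pow_left k
  rw [hc.card_divisors_mul, Nat.divisors_prime_pow hp, Finset.card_map, Finset.card_range] at h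
  have hk : k ≠ 0 := by
    rintro rfl
    simp only [pow_zero, one_mul] at hpn
    exact hm hpn
  have hk5 : k + 1 = 5 :=
    ((Nat.dvd_prime Nat.prime_five).1 (Dvd.intro _ h)).resolve_left (by omega)
  have hm1 : m.divisors.card = 1 := by rw [hk5] at h; omega
  have hm1' : m = 1 := by
    obtain ⟨a, ha⟩ := Finset.card_eq_one.1 hm1
    have hm0 : m ≠ 0 := by rintro rfl; simp at hm
    have h1 : 1 = a := by simpa [ha] using Nat.one_mem_divisors.2 hm0
    have h2 : m = a := by simpa [ha] using Nat.mem_divisors_self m hm0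
    exact h2.trans h1.symm
  exact ⟨p, hp, by rw [hm1', show k = 4 by omega, mul_one]⟩

theorem IsCyclic.subgroup_eq_of_card_eq {G : Type*} [Group G] [Finite G] [IsCyclic G]
    {H K : Subgroup G} (h : Nat.card H = Nat.card K) : H = K := by
  classical
  have := Fintype.ofFinite G
  let T : Finset G := {g | g ^ Nat.card H = 1}
  have hT : T.card ≤ Nat.card H := IsCyclic.card_pow_eq_one_le Nat.card_pos
  have key (L : Subgroup G) (hL : Nat.card L = Nat.card H) : (L : Set G) = T := by
    refine Set.eq_of_subset_of_ncard_le (fun g hg => ?_) ?_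
    · have := pow_card_eq_one' (x := (⟨g, hg⟩ : L))
      rw [hL] at this
      simpa [T] using congrArg Subtype.val this
    · rw [Set.ncard_coe_finset]
      exact hT.trans_eq hL.symm
  exact SetLike.coe_injective ((key H rfl).trans (key K h.symm).symm)

theorem IsCyclic.natCard_subgroup (G : Type*) [Group G] [Finite G] [IsCyclic G] :
    Nat.card (Subgroup G) = (Nat.card G).divisors.card := by
  rw [← Nat.card_eq_finsetCard]
  refine Nat.card_eq_of_bijective
    (fun H => ⟨Nat.card H, Nat.mem_divisors.2 ⟨H.card_subgroup_dvd_card, Nat.card_pos.ne'⟩⟩)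
    ⟨fun H K h => IsCyclic.subgroup_eq_of_card_eq (congrArg Subtype.val h), fun ⟨d, hd⟩ => ?_⟩
  obtain ⟨⟨m, hm⟩, -⟩ := Nat.mem_divisors.1 hd
  obtain ⟨g, hg⟩ := IsCyclic.exists_ofOrder_eq_natCard (α := G)
  have hm0 : m ≠ 0 := by rintro rfl; exact Nat.card_pos.ne' hm
  refine ⟨Subgroup.zpowers (g ^ m), Subtype.ext ?_⟩
  change Nat.card (Subgroup.zpowers (g ^ m)) = d
  rw [Nat.card_zpowers, orderOf_pow_of_dvd hm0 (by rw [hg, hm]; exact dvd_mul_left _ _), hg, hm,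
    Nat.mul_div_cancel _ (Nat.pos_of_ne_zero hm0)]

theorem nonempty_mulEquiv_zmod_three_prod {G : Type*} [Group G] [Finite G]
    (hG : Nat.card G = 9) (hc : ¬ IsCyclic G) :
    Nonempty (G ≃* (Multiplicative (ZMod 3) × Multiplicative (ZMod 3))) := by
  have : Fact (Nat.Prime 3) := ⟨Nat.prime_three⟩
  let _ : CommGroup G := IsPGroup.commGroupOfCardEqPrimeSq (p := 3) hG
  have hexp (g : G) : g ^ 3 = 1 := by
    have h1 : orderOf g ∣ 3 ^ 2 := by simpa [hG] using orderOf_dvd_natCard g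
    obtain ⟨k, hk, hk'⟩ := (Nat.dvd_prime_pow Nat.prime_three).1 h1
    rw [← orderOf_dvd_iff_pow_eq_one, hk']
    have : k ≠ 2 := by
      rintro rfl
      exact hc (isCyclic_of_orderOf_eq_card g (by rw [hk', hG]; norm_num))
    exact pow_dvd_pow 3 (show k ≤ 1 by omega)
  let _ : Module (ZMod 3) (Additive G) := AddCommGroup.zmodModule (n := 3) (fun x => hexp x.toMul)
  have hr : Module.finrank (ZMod 3) (Additive G) = 2 := by
    have := Module.natCard_eq_pow_finrank (K := ZMod 3) (V := Additive G)
    rw [show Nat.card (Additive G) = 3 ^ 2 from hG, Nat.card_zmod] at this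
    exact (Nat.pow_right_injective (a := 3) (by norm_num) this).symm
  obtain ⟨f⟩ := FiniteDimensional.nonempty_linearEquiv_of_finrank_eq
    (R := ZMod 3) (M := Additive G) (M' := ZMod 3 × ZMod 3) (by simp [hr])
  exact ⟨(AddEquiv.toMultiplicativeRight f.toAddEquiv).trans (MulEquiv.prodMultiplicative _ _)⟩

theorem eq_one_or_eq_of_mem_zpowers {G : Type*} [Group G] {g z : G} (hz : z ^ 2 = 1)
    (hg : g ∈ Subgroup.zpowers z) : g = 1 ∨ g = z := by
  obtain ⟨k, rfl⟩ := Subgroup.mem_zpowers_iff.1 hg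
  have hz' : z ^ (2 : ℤ) = 1 := by exact_mod_cast hz
  rcases Int.even_or_odd' k with ⟨m, rfl | rfl⟩
  · left
    rw [zpow_mul, hz', one_zpow]
  · right
    rw [zpow_add, zpow_mul, hz', one_zpow, one_mul, zpow_one]

theorem nonempty_mulEquiv_perm_fin_three {G : Type*} [Group G] [Finite G]
    (hG : Nat.card G = 6) (hc : ¬ IsCyclic G) : Nonempty (G ≃* Equiv.Perm (Fin 3)) := by
  have : Fact (Nat.Prime 2) := ⟨Nat.prime_two⟩
  have : Fact (Nat.Prime 3) := ⟨Nat.prime_three⟩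
  obtain ⟨z, hz⟩ := exists_prime_orderOf_dvd_card' (G := G) 2 (by rw [hG]; norm_num)
  obtain ⟨y, hy⟩ := exists_prime_orderOf_dvd_card' (G := G) 3 (by rw [hG]; norm_num)
  have hzy : ¬ Commute z y := fun h =>
    hc (isCyclic_of_orderOf_eq_card (z * y)
      (by rw [h.orderOf_mul_eq_mul_orderOf_of_coprime (by rw [hz, hy]; norm_num), hz, hy, hG]))
  have hz2 : z ^ 2 = 1 := hz ▸ pow_orderOf_eq_one z
  let H := Subgroup.zpowers z
  have hH : Nat.card H = 2 := (Nat.card_zpowers z).trans hz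
  have hcore : H.normalCore = ⊥ := by
    refine (Subgroup.eq_bot_iff_forall _).2 fun g hg => ?_
    refine (eq_one_or_eq_of_mem_zpowers hz2 (H.normalCore_le hg)).resolve_right ?_
    rintro rfl
    rcases eq_one_or_eq_of_mem_zpowers hz2
        (H.normalCore_le (H.normalCore_normal.conj_mem g hg y)) with h | h
    · rw [conj_eq_one_iff] at h
      simp [h] at hz
    · exact hzy (mul_inv_eq_iff_eq_mul.1 h).symm
  have hcard : Nat.card (G ⧸ H) = 3 := by
    have := H.card_mul_index
    rw [hH, hG, Subgroup.index] at this
    omega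
  have hinj : Function.Injective (MulAction.toPermHom G (G ⧸ H)) := by
    rw [← MonoidHom.ker_eq_bot_iff, ← Subgroup.normalCore_eq_ker, hcore]
  have hbij : Function.Bijective (MulAction.toPermHom G (G ⧸ H)) :=
    (Nat.bijective_iff_injective_and_card _).2 ⟨hinj, by rw [Nat.card_perm, hcard, hG]; rfl⟩
  exact ⟨(MulEquiv.ofBijective _ hbij).trans
    (Finite.equivFinOfCardEq hcard).permCongrHom⟩

theorem nonempty_mulEquiv_quaternionGroup_two {G : Type*} [Group G] [Finite G]
    (hG : Nat.card G = 8) (hc : ¬ IsCyclic G) {x y z : G} (hx : orderOf x = 4)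
    (hy : y ∉ Subgroup.zpowers x) (hz : ∀ g : G, g ^ 2 = 1 → g = 1 ∨ g = z) : Nonempty (G ≃* QuaternionGroup 2) := by
  have hx4 : x ^ 4 = 1 := hx ▸ pow_orderOf_eq_one x
  have hx2 : x ^ 2 ≠ 1 := fun h => by
    have := orderOf_dvd_of_pow_eq_one h
    rw [hx] at this
    norm_num at this
  have hxz : x ^ 2 = z := (hz (x ^ 2) (by rw [← pow_mul]; exact hx4)).resolve_left hx2
  have hsq (g : G) (hg : g ^ 2 = 1) : g ∈ Subgroup.zpowers x := by
    rcases hz g hg with rfl | rfl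
    · exact one_mem _
    · exact hxz ▸ Subgroup.npow_mem_zpowers x 2
  have hindex : (Subgroup.zpowers x).index = 2 := by
    have := (Subgroup.zpowers x).card_mul_index
    rw [Nat.card_zpowers, hx, hG] at this
    omega
  have hxpow (g : G) (hg : g ∈ Subgroup.zpowers x) : g = 1 ∨ g = x ∨ g = x ^ 2 ∨ g = x ^ 3 := by
    classical
    rw [mem_zpowers_iff_mem_range_orderOf, hx] at hg
    obtain ⟨k, hk, rfl⟩ := Finset.mem_image.1 hg
    have := Finset.mem_range.1 hk
    interval_cases k <;> simp
  have hyy : y ^ 2 = x ^ 2 := by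
    have h1 : orderOf y ∣ 2 ^ 3 := by
      rw [show 2 ^ 3 = Nat.card G from hG.symm]
      exact orderOf_dvd_natCard y
    obtain ⟨k, hk, hk'⟩ := (Nat.dvd_prime_pow Nat.prime_two).1 h1
    have hk3 : k ≠ 3 := by
      rintro rfl
      exact hc (isCyclic_of_orderOf_eq_card y (hk'.trans hG.symm))
    have hy4 : y ^ 4 = 1 := by
      rw [← orderOf_dvd_iff_pow_eq_one, hk']
      exact pow_dvd_pow 2 (show k ≤ 2 by omega)
    rcases hz (y ^ 2) (by rw [← pow_mul]; exact hy4) with h | h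
    · exact absurd (hsq y h) hy
    · rw [h, hxz]
  have hnormal := Subgroup.normal_of_index_eq_two hindex
  have hconj : x * y = y * x⁻¹ := by
    rcases hxpow _ (hnormal.conj_mem x (Subgroup.mem_zpowers x) y) with h | h | h | h
    · rw [conj_eq_one_iff] at h
      simp [h] at hx2
    · have hcomm : Commute y x := mul_inv_eq_iff_eq_mul.1 h
      have : (y * x⁻¹) ^ 2 = 1 := by
        rw [hcomm.inv_right.mul_pow, hyy, inv_pow, mul_inv_cancel]
      exact absurd ((Subgroup.mul_mem_cancel_right _ (inv_mem (Subgroup.mem_zpowers x))).1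
        (hsq _ this)) hy
    · have h2 : (y * x * y⁻¹) ^ 2 = 1 := by rw [h, ← pow_mul]; exact hx4
      rw [conj_pow, conj_eq_one_iff] at h2
      exact absurd h2 hx2
    · rw [eq_inv_of_mul_eq_one_left ((pow_succ x 3).symm.trans hx4),
        mul_inv_eq_iff_eq_mul] at h
      rw [eq_mul_inv_iff_mul_eq, mul_assoc, h, mul_inv_cancel_left]
  let p (i : ZMod 4) : G := x ^ i.val
  have hpadd (i j : ZMod 4) : p (i + j) = p i * p j := by
    simp only [p]
    rw [ZMod.val_add, ← pow_add, pow_eq_pow_mod (i.val + j.val) hx4]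
  have hpy (i : ZMod 4) : p i * y = y * p (-i) := by
    have hneg : p (-i) = (p i)⁻¹ := by
      rw [eq_inv_iff_mul_eq_one, ← hpadd, neg_add_cancel]
      simp [p]
    have : SemiconjBy y x⁻¹ x := hconj.symm
    rw [hneg]
    simpa [p] using (this.pow_right i.val).symm
  have hp2 : y * y = p 2 := by rw [← sq, hyy]; rfl
  let f : QuaternionGroup 2 →* G :=
    { toFun := fun q => match q with
        | .a i => p i
        | .xa i => y * p i
      map_one' := by exact pow_zero x
      map_mul' := by
        rintro (i | i) (j | j)
        · simpa using! hpadd i j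
        · simp only [QuaternionGroup.a_mul_xa]
          rw [← mul_assoc, hpy, mul_assoc, ← hpadd, neg_add_eq_sub]
        · simp only [QuaternionGroup.xa_mul_a]
          rw [mul_assoc, ← hpadd]
        · simp only [QuaternionGroup.xa_mul_xa]
          rw [mul_assoc, ← mul_assoc (p i), hpy, mul_assoc, ← hpadd, ← mul_assoc, hp2, ← hpadd]
          congr 1
          push_cast
          ring }
  have hinj : Function.Injective f := by
    rw [injective_iff_map_eq_one]
    rintro (i | i) h
    · change x ^ i.val = 1 at h
      have hdvd := orderOf_dvd_of_pow_eq_one h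
      rw [hx] at hdvd
      have := Nat.eq_zero_of_dvd_of_lt hdvd (ZMod.val_lt i)
      rw [(ZMod.val_eq_zero i).1 this, QuaternionGroup.one_def]
    · change y * x ^ i.val = 1 at h
      refine absurd ?_ hy
      rw [eq_inv_of_mul_eq_one_left h]
      exact inv_mem (Subgroup.npow_mem_zpowers x _)
  have hbij : Function.Bijective f :=
    (Nat.bijective_iff_injective_and_card _).2 ⟨hinj, by
      rw [hG, Nat.card_eq_fintype_card, QuaternionGroup.card]⟩
  exact ⟨(MulEquiv.ofBijective f hbij).symm⟩

theorem Subgroup.relIndex_mul_card_inf {G : Type*} [Group G] (A H : Subgroup G) :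
    A.relIndex H * Nat.card (A ⊓ H : Subgroup G) = Nat.card H := by
  have := relIndex_mul_relIndex ⊥ (A ⊓ H) H bot_le inf_le_right
  rwa [relIndex_bot_left, relIndex_bot_left, inf_relIndex_right, mul_comm] at this

theorem Subgroup.ncard_sdiff_add_card_inf {G : Type*} [Group G] [Finite G] (A H : Subgroup G) :
    ((H : Set G) \ A).ncard + Nat.card (A ⊓ H : Subgroup G) = Nat.card H := by
  rw [inf_comm, add_comm]
  exact Set.ncard_inter_add_ncard_sdiff_eq_ncard (H : Set G) A

theorem Subgroup.relIndex_le_index {G : Type*} [Group G] [Finite G] (A H : Subgroup G) :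
    A.relIndex H ≤ A.index := by
  rw [← A.relIndex_top_right]
  exact relIndex_le_of_le_right le_top (by rw [relIndex_top_right]; exact index_ne_zero_of_finite)

theorem Subgroup.card_inf_of_index_two {G : Type*} [Group G] [Finite G] {A H : Subgroup G}
    (hA : A.index = 2) (hH : ¬ H ≤ A) : 2 * Nat.card (A ⊓ H : Subgroup G) = Nat.card H := by
  have h1 := A.relIndex_mul_card_inf H
  have h2 := A.relIndex_le_index H
  have h3 := mt Subgroup.relIndex_eq_one.1 hH
  have h4 : A.relIndex H ≠ 0 := fun h0 => by
    rw [h0, zero_mul] at h1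
    exact Nat.card_pos.ne h1
  rw [show A.relIndex H = 2 by omega] at h1
  exact h1

theorem Subgroup.card_le_of_union {G : Type*} [Group G] [Finite G] {A B C D : Subgroup G}
    (h : ∀ g : G, g ∈ A ∨ g ∈ B ∨ g ∈ C ∨ g ∈ D) :
    Nat.card G ≤ Nat.card A + ((B : Set G) \ A).ncard + ((C : Set G) \ A).ncard
      + ((D : Set G) \ A).ncard := by
  have h1 : (Set.univ : Set G) ⊆ (((A : Set G) ∪ (B \ A)) ∪ (C \ A)) ∪ (D \ A) := by
    intro g _
    have := h g
    simp only [Set.mem_union, Set.mem_sdiff, SetLike.mem_coe]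
    tauto
  rw [← Set.ncard_univ]
  refine (Set.ncard_le_ncard h1).trans ?_
  refine (Set.ncard_union_le _ _).trans (Nat.add_le_add_right ?_ _)
  refine (Set.ncard_union_le _ _).trans (Nat.add_le_add_right ?_ _)
  exact Set.ncard_union_le _ _

theorem natCard_cyclic_subgroups_le {G : Type*} [Group G] [Finite G] :
    Nat.card {H : Subgroup G // IsCyclic H} ≤ Nat.card G := by
  have (H : {H : Subgroup G // IsCyclic H}) : ∃ g : G, Subgroup.zpowers g = H.1 :=
    (Subgroup.isCyclic_iff_exists_zpowers_eq_top _).1 H.2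
  choose f hf using this
  exact Nat.card_le_card_of_injective f fun H K h =>
    Subtype.ext ((hf H).symm.trans ((congrArg _ h).trans (hf K)))

theorem card_of_index_two_of_le {G : Type*} [Group G] [Finite G] {A B C D : Subgroup G}
    (hcyc : ∀ H : Subgroup G, IsCyclic H ↔ H = ⊥ ∨ H = A ∨ H = B ∨ H = C ∨ H = D)
    (hmax : ∀ H : Subgroup G, IsCyclic H → Nat.card H ≤ Nat.card A)
    (hcover : ∀ g : G, g ∈ A ∨ g ∈ B ∨ g ∈ C ∨ g ∈ D) (hindex : A.index = 2)
    (hB : ¬ B ≤ A) (hC : ¬ C ≤ A) (hD : D ≤ A) (hDbot : D ≠ ⊥) (hDA : D ≠ A) :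
    Nat.card G = 8 ∧ ∃ x y z : G, orderOf x = 4 ∧ y ∉ Subgroup.zpowers x ∧
      ∀ g : G, g ^ 2 = 1 → g = 1 ∨ g = z := by
  have hAc : IsCyclic A := (hcyc A).2 (by simp)
  have hBc : IsCyclic B := (hcyc B).2 (by simp)
  have hCc : IsCyclic C := (hcyc C).2 (by simp)
  have hle := Subgroup.card_le_of_union hcover
  rw [Set.sdiff_eq_empty.2 (SetLike.coe_subset_coe.2 hD), Set.ncard_empty,
    ← A.card_mul_index, hindex] at hle
  have hBi := Subgroup.card_inf_of_index_two hindex hB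
  have hCi := Subgroup.card_inf_of_index_two hindex hC
  have hBd := A.ncard_sdiff_add_card_inf B
  have hCd := A.ncard_sdiff_add_card_inf C
  have hBm := hmax B hBc
  have hCm := hmax C hCc
  have hBcard : Nat.card B = Nat.card A := by omega
  have hCcard : Nat.card C = Nat.card A := by omega
  have hApos : 0 < Nat.card A := Nat.card_pos
  have hDgt : 1 < Nat.card D := D.one_lt_card_iff_ne_bot.2 hDbot
  have hDlt : Nat.card D < Nat.card A := by
    by_contra! hge
    exact hDA (Subgroup.eq_of_le_of_card_ge hD hge)
  have hinf : A ⊓ B = D := by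
    rcases (hcyc (A ⊓ B)).1 (Subgroup.isCyclic_of_le inf_le_left) with h | h | h | h | h
    · rw [h, Subgroup.card_bot] at hBi
      omega
    all_goals first | exact h | (rw [h] at hBi; omega)
  rw [hinf] at hBi
  have : Fact (Nat.Prime 2) := ⟨Nat.prime_two⟩
  obtain ⟨u, hu⟩ := exists_prime_orderOf_dvd_card' (G := A) 2 ⟨Nat.card D, by omega⟩
  have horder (g : G) (hg : orderOf g = 2) : Subgroup.zpowers g = D := by
    have hcard := (Nat.card_zpowers g).trans hg
    rcases (hcyc (Subgroup.zpowers g)).1 inferInstance with h | h | h | h | h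
    · rw [h, Subgroup.card_bot] at hcard
      omega
    all_goals first | exact h | (rw [h] at hcard; omega)
  have hu' : orderOf (u : G) = 2 := by rw [Subgroup.orderOf_coe, hu]
  have hDu := horder _ hu'
  have hD2 : Nat.card D = 2 := by rw [← hDu, Nat.card_zpowers, hu']
  have hA4 : Nat.card A = 4 := by omega
  obtain ⟨x, rfl⟩ := (Subgroup.isCyclic_iff_exists_zpowers_eq_top A).1 hAc
  obtain ⟨y, rfl⟩ := (Subgroup.isCyclic_iff_exists_zpowers_eq_top B).1 hBc
  refine ⟨by rw [← (Subgroup.zpowers x).card_mul_index, hindex, hA4], x, y, u,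
    by rw [← Nat.card_zpowers, hA4], fun h => hB (Subgroup.zpowers_le.2 h), fun g hg => ?_⟩
  by_cases hg1 : g = 1
  · exact Or.inl hg1
  · refine eq_one_or_eq_of_mem_zpowers (hu' ▸ pow_orderOf_eq_one (u : G)) ?_
    rw [hDu, ← horder g (orderOf_eq_prime hg hg1)]
    exact Subgroup.mem_zpowers g

theorem card_eq_six_of_index_two {G : Type*} [Group G] [Finite G] {A B C D : Subgroup G}
    (hcyc : ∀ H : Subgroup G, IsCyclic H ↔ H = ⊥ ∨ H = A ∨ H = B ∨ H = C ∨ H = D)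
    (hcover : ∀ g : G, g ∈ A ∨ g ∈ B ∨ g ∈ C ∨ g ∈ D) (hfive : 5 ≤ Nat.card G)
    (hmax : ∀ H : Subgroup G, IsCyclic H → Nat.card H ≤ Nat.card A)
    (hindex : A.index = 2) (hB : ¬ B ≤ A) (hC : ¬ C ≤ A) (hD : ¬ D ≤ A) : Nat.card G = 6 := by
  have hinf (H : Subgroup G) (hH : H = B ∨ H = C ∨ H = D) : A ⊓ H = ⊥ := by
    have hHA : ¬ H ≤ A := by rcases hH with rfl | rfl | rfl <;> assumption
    have hAc : IsCyclic A := (hcyc A).2 (by simp)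
    rcases (hcyc (A ⊓ H)).1 (Subgroup.isCyclic_of_le inf_le_left) with h | h | h | h | h
    · exact h
    · have hAH : A ≤ H := inf_eq_left.1 h
      exact absurd (Subgroup.eq_of_le_of_card_ge hAH
        (hmax H ((hcyc H).2 (by tauto)))).ge hHA
    · exact absurd (h ▸ inf_le_left) hB
    · exact absurd (h ▸ inf_le_left) hC
    · exact absurd (h ▸ inf_le_left) hD
  have hone (H : Subgroup G) (hH : H = B ∨ H = C ∨ H = D) : ((H : Set G) \ A).ncard = 1 := by
    have hHA : ¬ H ≤ A := by rcases hH with rfl | rfl | rfl <;> assumption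
    have h1 := Subgroup.card_inf_of_index_two hindex hHA
    have h2 := A.ncard_sdiff_add_card_inf H
    rw [hinf H hH, Subgroup.card_bot] at h1 h2
    omega
  have hle := Subgroup.card_le_of_union hcover
  rw [hone B (by simp), hone C (by simp), hone D (by simp)] at hle
  have := A.card_mul_index
  rw [hindex] at this
  omega

theorem card_eq_nine_of_index_three {G : Type*} [Group G] [Finite G] {A B C D : Subgroup G}
    (hcyc : ∀ H : Subgroup G, IsCyclic H ↔ H = ⊥ ∨ H = A ∨ H = B ∨ H = C ∨ H = D)
    (hcover : ∀ g : G, g ∈ A ∨ g ∈ B ∨ g ∈ C ∨ g ∈ D)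
    (hmax : ∀ H : Subgroup G, IsCyclic H → Nat.card H ≤ Nat.card A)
    (hindex : A.index = 3) : Nat.card G = 9 := by
  have hAc : IsCyclic A := (hcyc A).2 (by simp)
  have hbound (H : Subgroup G) : Nat.card H ≤ 3 * Nat.card (A ⊓ H : Subgroup G) := by
    rw [← A.relIndex_mul_card_inf H]
    exact Nat.mul_le_mul_right _ (hindex ▸ A.relIndex_le_index H)
  have hle := Subgroup.card_le_of_union hcover
  rw [← A.card_mul_index, hindex] at hle
  have hBd := A.ncard_sdiff_add_card_inf B
  have hCd := A.ncard_sdiff_add_card_inf C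
  have hDd := A.ncard_sdiff_add_card_inf D
  have hBi := hbound B
  have hCi := hbound C
  have hDi := hbound D
  have hBm := hmax B ((hcyc B).2 (by simp))
  have hCm := hmax C ((hcyc C).2 (by simp))
  have hDm := hmax D ((hcyc D).2 (by simp))
  have hApos : 0 < Nat.card A := Nat.card_pos
  have hinf : 3 * Nat.card (A ⊓ B : Subgroup G) = Nat.card A := by omega
  rw [← A.card_mul_index, hindex]
  rcases (hcyc (A ⊓ B)).1 (Subgroup.isCyclic_of_le inf_le_left) with h | h | h | h | h
  · rw [h, Subgroup.card_bot] at hinf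
    omega
  all_goals
    rw [h] at hinf
    omega

theorem card_of_not_isCyclic {G : Type*} [Group G] [Finite G] (hc : ¬ IsCyclic G)
    (h : Nat.card {H : Subgroup G // IsCyclic H} = 5) :
    Nat.card G = 6 ∨ Nat.card G = 9 ∨ Nat.card G = 8 ∧ ∃ x y z : G, orderOf x = 4 ∧
      y ∉ Subgroup.zpowers x ∧ ∀ g : G, g ^ 2 = 1 → g = 1 ∨ g = z := by
  classical
  have := Fintype.ofFinite (Subgroup G)
  let S : Finset (Subgroup G) := {H | IsCyclic H}
  have hS : S.card = 5 := by rw [← h, Nat.card_eq_fintype_card, Fintype.card_subtype]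
  have hbot : ⊥ ∈ S := by simpa [S] using (inferInstance : IsCyclic (⊥ : Subgroup G))
  obtain ⟨A, hAS, hAmax⟩ := S.exists_max_image (fun H => Nat.card H) ⟨⊥, hbot⟩
  have hmax (H : Subgroup G) (hH : IsCyclic H) : Nat.card H ≤ Nat.card A :=
    hAmax H (by simpa [S] using hH)
  have hzp (g : G) : Subgroup.zpowers g ∈ S := by
    simpa [S] using (inferInstance : IsCyclic (Subgroup.zpowers g))
  have hAbot : A ≠ ⊥ := by
    rintro rfl
    have hall : S ⊆ {⊥} := fun H hH => by
      have := hAmax H hH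
      rw [Subgroup.card_bot] at this
      exact Finset.mem_singleton.2 (Subgroup.card_le_one_iff_eq_bot H |>.1 this)
    have := Finset.card_le_card hall
    rw [hS, Finset.card_singleton] at this
    omega
  have h3 : ((S.erase ⊥).erase A).card = 3 := by
    rw [Finset.card_erase_of_mem (Finset.mem_erase.2 ⟨hAbot, hAS⟩), Finset.card_erase_of_mem hbot,
      hS]
  obtain ⟨B, C, D, -, -, -, hBCD⟩ := Finset.card_eq_three.1 h3
  have hmem (H : Subgroup G) : (H ≠ A ∧ H ≠ ⊥ ∧ IsCyclic H) ↔ H = B ∨ H = C ∨ H = D := by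
    simpa [S] using Finset.ext_iff.1 hBCD H
  have hcyc (H : Subgroup G) : IsCyclic H ↔ H = ⊥ ∨ H = A ∨ H = B ∨ H = C ∨ H = D := by
    rw [← hmem H]
    have hA : IsCyclic A := by simpa [S] using hAS
    constructor
    · tauto
    · rintro (rfl | rfl | h)
      · infer_instance
      · exact hA
      · exact h.2.2
  obtain ⟨hBA, hB0, -⟩ := (hmem B).2 (by simp)
  obtain ⟨hCA, hC0, -⟩ := (hmem C).2 (by simp)
  obtain ⟨hDA, hD0, -⟩ := (hmem D).2 (by simp)
  have hcover (g : G) : g ∈ A ∨ g ∈ B ∨ g ∈ C ∨ g ∈ D := by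
    have hg := Subgroup.mem_zpowers g
    rcases (hcyc (Subgroup.zpowers g)).1 inferInstance with h | h | h | h | h <;> rw [h] at hg
    · exact Or.inl (Subgroup.mem_bot.1 hg ▸ one_mem A)
    all_goals tauto
  have hfive : 5 ≤ Nat.card G := h ▸ natCard_cyclic_subgroups_le
  have hle := Subgroup.card_le_of_union hcover
  have hBd := A.ncard_sdiff_add_card_inf B
  have hCd := A.ncard_sdiff_add_card_inf C
  have hDd := A.ncard_sdiff_add_card_inf D
  have hBm := hmax B ((hcyc B).2 (by simp))
  have hCm := hmax C ((hcyc C).2 (by simp))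
  have hDm := hmax D ((hcyc D).2 (by simp))
  have hBp : 0 < Nat.card (A ⊓ B : Subgroup G) := Nat.card_pos
  have hCp : 0 < Nat.card (A ⊓ C : Subgroup G) := Nat.card_pos
  have hDp : 0 < Nat.card (A ⊓ D : Subgroup G) := Nat.card_pos
  have hmul := A.card_mul_index
  have hlt : A.index < 4 := by
    by_contra! hge
    have := Nat.mul_le_mul_left (Nat.card A) hge
    omega
  have h0 : A.index ≠ 0 := Subgroup.index_ne_zero_of_finite
  have h1 : A.index ≠ 1 := fun h1 => by
    rw [Subgroup.index_eq_one] at h1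
    have hA : IsCyclic A := by simpa [S] using hAS
    rw [h1] at hA
    exact hc (Subgroup.topEquiv.isCyclic.1 hA)
  obtain hindex | hindex : A.index = 2 ∨ A.index = 3 := by omega
  · rw [hindex] at hmul
    have hzero {H : Subgroup G} (hH : H ≤ A) : ((H : Set G) \ A).ncard = 0 := by
      rw [Set.sdiff_eq_empty.2 (SetLike.coe_subset_coe.2 hH), Set.ncard_empty]
    by_cases hB : B ≤ A <;> by_cases hC : C ≤ A <;> by_cases hD : D ≤ A
    · have := hzero hB; have := hzero hC; omega
    · have := hzero hB; have := hzero hC; omega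
    · have := hzero hB; have := hzero hD; omega
    · exact Or.inr (Or.inr (card_of_index_two_of_le (B := C) (C := D) (D := B)
        (fun H => by rw [hcyc]; tauto) hmax (fun g => by have := hcover g; tauto)
        hindex hC hD hB hB0 hBA))
    · have := hzero hC; have := hzero hD; omega
    · exact Or.inr (Or.inr (card_of_index_two_of_le (B := B) (C := D) (D := C)
        (fun H => by rw [hcyc]; tauto) hmax (fun g => by have := hcover g; tauto)
        hindex hB hD hC hC0 hCA))
    · exact Or.inr (Or.inr (card_of_index_two_of_le hcyc hmax hcover hindex hB hC hD hD0 hDA))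
    · exact Or.inl (card_eq_six_of_index_two hcyc hcover hfive hmax hindex hB hC hD)
  · exact Or.inr (Or.inl (card_eq_nine_of_index_three hcyc hcover hmax hindex))

theorem stmt_2 {G : Type*} [Group G] [Finite G]
    (h : Nat.card {H : Subgroup G // IsCyclic H} = 5) :
    Nonempty (G ≃* Equiv.Perm (Fin 3)) ∨
    (∃ p : ℕ, p.Prime ∧ Nonempty (G ≃* Multiplicative (ZMod (p ^ 4)))) ∨
    Nonempty (G ≃* (Multiplicative (ZMod 3) × Multiplicative (ZMod 3))) ∨
    Nonempty (G ≃* QuaternionGroup 2) := by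
  by_cases hc : IsCyclic G
  · have hcard : Nat.card {H : Subgroup G // IsCyclic H} = Nat.card (Subgroup G) :=
      Nat.card_congr (Equiv.subtypeUnivEquiv fun H => inferInstance)
    rw [hcard, IsCyclic.natCard_subgroup] at h
    obtain ⟨p, hp, hn⟩ := Nat.exists_prime_pow_of_card_divisors_eq_five h
    refine Or.inr (Or.inl ⟨p, hp, ⟨mulEquivOfCyclicCardEq ?_⟩⟩)
    rw [hn]
    exact (Nat.card_zmod _).symm
  · rcases card_of_not_isCyclic hc h with h6 | h9 | ⟨h8, x, y, z, hx, hy, hz⟩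
    · exact Or.inl (nonempty_mulEquiv_perm_fin_three h6 hc)
    · exact Or.inr (Or.inr (Or.inl (nonempty_mulEquiv_zmod_three_prod h9 hc)))
    · exact Or.inr (Or.inr (Or.inr (nonempty_mulEquiv_quaternionGroup_two h8 hc hx hy hz)))
end

section
/- For a finite group G, the number of cyclic subgroups of G equals the order of G if and only if G is an elementary abelian 2-group (i.e., every element of G satisfies x^2 = 1). -/
/-- The map sending an element of a group to the cyclic subgroup it generates. -/
def cyclicSubgroupOf {G : Type*} [Group G] (x : G) : {H : Subgroup G // IsCyclic H} :=
  ⟨Subgroup.zpowers x, inferInstance⟩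

theorem cyclicSubgroupOf_surjective {G : Type*} [Group G] :
    Function.Surjective (cyclicSubgroupOf (G := G)) := by
  rintro ⟨H, hH⟩
  obtain ⟨x, hx⟩ := (Subgroup.isCyclic_iff_exists_zpowers_eq_top H).1 hH
  exact ⟨x, Subtype.ext hx⟩

theorem cyclicSubgroupOf_injective_iff {G : Type*} [Group G] :
    Function.Injective (cyclicSubgroupOf (G := G)) ↔ ∀ x : G, x ^ 2 = 1 := by
  constructor
  · intro h x
    have hx : x⁻¹ = x := h (Subtype.ext (Subgroup.zpowers_inv))
    rw [pow_two, mul_eq_one_iff_eq_inv, hx]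
  · intro h x y hxy
    have hz : Subgroup.zpowers x = Subgroup.zpowers y := congrArg Subtype.val hxy
    have hy : y ∈ Subgroup.zpowers x := hz ▸ Subgroup.mem_zpowers y
    have hsq : x ^ (2 : ℤ) = 1 := by exact_mod_cast h x
    obtain ⟨k, rfl⟩ := Subgroup.mem_zpowers_iff.1 hy
    obtain ⟨m, rfl | rfl⟩ := Int.even_or_odd' k
    · rw [zpow_mul, hsq, one_zpow] at hz ⊢
      rwa [Subgroup.zpowers_one_eq_bot, Subgroup.zpowers_eq_bot] at hz
    · rw [zpow_add_one, zpow_mul, hsq, one_zpow, one_mul]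

theorem stmt_6 {G : Type*} [Group G] [Finite G] :
    Nat.card {H : Subgroup G // IsCyclic H} = Nat.card G ↔
    (∀ x : G, x ^ 2 = 1) := by
  rw [← cyclicSubgroupOf_injective_iff]
  constructor
  · intro h
    exact ((Nat.bijective_iff_surjective_and_card _).2
      ⟨cyclicSubgroupOf_surjective, h.symm⟩).injective
  · intro h
    exact (Nat.card_eq_of_bijective _ ⟨h, cyclicSubgroupOf_surjective⟩).symm
end

section
/- Let G be a finite group with exactly 5 cyclic subgroups. Then the number of distinct prime divisors of the order of G is at most 2. -/
theorem Subgroup.normal_of_unique_isCyclic_of_card {G : Type*} [Group G] {A : Subgroup G}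
    (hc : IsCyclic A) (hA : ∀ H : Subgroup G, IsCyclic H → Nat.card H = Nat.card A → H = A) :
    A.Normal := by
  refine ⟨fun n hn g => ?_⟩
  have e := A.equivMapOfInjective (MulAut.conj g).toMonoidHom (MulAut.conj g).injective
  have h := hA (A.map (MulAut.conj g).toMonoidHom) (isCyclic_of_surjective e e.surjective)
    (Nat.card_congr e.toEquiv).symm
  rw [← h]
  exact ⟨n, hn, by simp⟩

theorem Subgroup.exists_isCyclic_card_mul_of_normal {G : Type*} [Group G] [Finite G]
    {A B : Subgroup G} (hA : IsCyclic A) (hB : IsCyclic B) (nA : A.Normal) (nB : B.Normal)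
    (hco : (Nat.card A).Coprime (Nat.card B)) :
    ∃ K : Subgroup G, IsCyclic K ∧ Nat.card K = Nat.card A * Nat.card B := by
  obtain ⟨a, ha⟩ := A.isCyclic_iff_exists_zpowers_eq_top.1 hA
  obtain ⟨b, hb⟩ := B.isCyclic_iff_exists_zpowers_eq_top.1 hB
  subst ha hb
  rw [Nat.card_zpowers, Nat.card_zpowers] at *
  have hd : Disjoint (Subgroup.zpowers a) (Subgroup.zpowers b) :=
    Subgroup.disjoint_of_coprime_natCard (by simpa using hco)
  have hab : Commute a b := Subgroup.commute_of_normal_of_disjoint _ _ nA nB hd a b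
    (Subgroup.mem_zpowers a) (Subgroup.mem_zpowers b)
  exact ⟨Subgroup.zpowers (a * b), inferInstance, by
    rw [Nat.card_zpowers, hab.orderOf_mul_eq_mul_orderOf_of_coprime hco]⟩

theorem exists_isCyclic_subgroup_card_eq_prime {G : Type*} [Group G] [Finite G] {p : ℕ}
    (hp : p ∈ (Nat.card G).primeFactors) :
    ∃ A : {H : Subgroup G // IsCyclic H}, Nat.card A.1 = p := by
  have : Fact p.Prime := ⟨Nat.prime_of_mem_primeFactors hp⟩
  obtain ⟨a, ha⟩ := exists_prime_orderOf_dvd_card' (G := G) p (Nat.dvd_of_mem_primeFactors hp)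
  exact ⟨⟨Subgroup.zpowers a, inferInstance⟩, by rw [Nat.card_zpowers, ha]⟩

theorem stmt_8 {G : Type*} [Group G] [Finite G]
    (h : Nat.card {H : Subgroup G // IsCyclic H} = 5) :
    (Nat.card G).primeFactors.card ≤ 2 := by
  classical
  by_contra! hlt
  obtain ⟨p, hp, q, hq, r, hr, hpq, hpr, hqr⟩ := Finset.two_lt_card.1 hlt
  obtain ⟨A, hA⟩ := exists_isCyclic_subgroup_card_eq_prime hp
  obtain ⟨B, hB⟩ := exists_isCyclic_subgroup_card_eq_prime hq
  obtain ⟨C, hC⟩ := exists_isCyclic_subgroup_card_eq_prime hr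
  replace hp := Nat.prime_of_mem_primeFactors hp
  replace hq := Nat.prime_of_mem_primeFactors hq
  replace hr := Nat.prime_of_mem_primeFactors hr
  let T : {H : Subgroup G // IsCyclic H} := ⟨⊥, inferInstance⟩
  have hT : Nat.card T.1 = 1 := Subgroup.card_bot
  have := hp.one_lt
  have := hq.one_lt
  have := hr.one_lt
  have h4 : ({T, A, B, C} : Finset {H : Subgroup G // IsCyclic H}).card = 4 := by
    have ne {D E : {H : Subgroup G // IsCyclic H}} (hDE : Nat.card D.1 ≠ Nat.card E.1) :
        D ≠ E := fun e => hDE (e ▸ rfl)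
    have hTA : T ≠ A := ne (by omega)
    have hTB : T ≠ B := ne (by omega)
    have hTC : T ≠ C := ne (by omega)
    have hAB : A ≠ B := ne (by omega)
    have hAC : A ≠ C := ne (by omega)
    have hBC : B ≠ C := ne (by omega)
    simp [*]
  have := Fintype.ofFinite {H : Subgroup G // IsCyclic H}
  rw [Nat.card_eq_fintype_card] at h
  obtain ⟨X, hX⟩ := Finset.card_eq_one.1
    (show (({T, A, B, C} : Finset {H : Subgroup G // IsCyclic H})ᶜ).card = 1 by
      rw [Finset.card_compl, h, h4])
  have cover (H : {H : Subgroup G // IsCyclic H}) : H = T ∨ H = A ∨ H = B ∨ H = C ∨ H = X := by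
    by_cases hH : H ∈ ({T, A, B, C} : Finset {H : Subgroup G // IsCyclic H})
    · simp only [Finset.mem_insert, Finset.mem_singleton] at hH
      tauto
    · rw [← Finset.mem_compl, hX, Finset.mem_singleton] at hH
      tauto
  have normal (D : {H : Subgroup G // IsCyclic H}) (hD : D = A ∨ D = B ∨ D = C)
      (hDX : Nat.card D.1 ≠ Nat.card X.1) : D.1.Normal := by
    refine Subgroup.normal_of_unique_isCyclic_of_card D.2 fun H hH hc => ?_
    rcases hD with rfl | rfl | rfl <;>
      rcases cover ⟨H, hH⟩ with e | e | e | e | e <;>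
      have e' := congrArg Subtype.val e <;> dsimp only at e' <;> subst e' <;>
      first | rfl | omega
  have pair (D E : {H : Subgroup G // IsCyclic H}) (hD : D = A ∨ D = B ∨ D = C)
      (hE : E = A ∨ E = B ∨ E = C) (hDE : Nat.card D.1 ≠ Nat.card E.1)
      (hDX : Nat.card D.1 ≠ Nat.card X.1) (hEX : Nat.card E.1 ≠ Nat.card X.1) :
      Nat.card D.1 * Nat.card E.1 = Nat.card X.1 := by
    have pD : (Nat.card D.1).Prime := by rcases hD with rfl | rfl | rfl <;> simp [*]
    have pE : (Nat.card E.1).Prime := by rcases hE with rfl | rfl | rfl <;> simp [*]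
    obtain ⟨K, hK, hc⟩ := Subgroup.exists_isCyclic_card_mul_of_normal D.2 E.2
      (normal D hD hDX) (normal E hE hEX) ((Nat.coprime_primes pD pE).2 hDE)
    have hnp : ¬ (Nat.card K).Prime := hc ▸ Nat.not_prime_mul pD.ne_one pE.ne_one
    have h1 : Nat.card K ≠ 1 := by
      rw [hc]
      exact fun e => pD.ne_one (Nat.eq_one_of_mul_eq_one_right e)
    rw [← hc]
    rcases cover ⟨K, hK⟩ with e | e | e | e | e <;>
      have e' := congrArg Subtype.val e <;> dsimp only at e' <;> subst e' <;>
      simp_all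
  have hAB := pair A B (by simp) (by simp) (by omega)
  have hAC := pair A C (by simp) (by simp) (by omega)
  have hBC := pair B C (by simp) (by simp) (by omega)
  rw [hA, hB] at hAB
  rw [hA, hC] at hAC
  rw [hB, hC] at hBC
  by_cases hx : p = Nat.card X.1
  · exact Nat.not_prime_mul hq.ne_one hr.ne_one ((hBC (by omega) (by omega)).trans hx.symm ▸ hp)
  by_cases hy : q = Nat.card X.1
  · exact Nat.not_prime_mul hp.ne_one hr.ne_one ((hAC (by omega) (by omega)).trans hy.symm ▸ hq)
  by_cases hz : r = Nat.card X.1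
  · exact Nat.not_prime_mul hp.ne_one hq.ne_one ((hAB (by omega) (by omega)).trans hz.symm ▸ hr)
  exact hqr (Nat.eq_of_mul_eq_mul_left hp.pos ((hAB hx hy).trans (hAC hx hz).symm))
end

section
/- Let G be a finite group with exactly 4 cyclic subgroups. Then the number of distinct prime divisors of the order of G is at most 2. -/
/-- If cyclic subgroups of `G` are determined by their order, they are normal. -/
theorem normal_zpowers_of_injective_card {G : Type*} [Group G]
    (hinj : Function.Injective fun H : {H : Subgroup G // IsCyclic H} => Nat.card H.1) (x : G) :
    (Subgroup.zpowers x).Normal := by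
  refine ⟨fun n hn g => ?_⟩
  have key : Subgroup.zpowers (g * x * g⁻¹) = Subgroup.zpowers x :=
    congrArg Subtype.val <| @hinj ⟨Subgroup.zpowers (g * x * g⁻¹), inferInstance⟩
      ⟨Subgroup.zpowers x, inferInstance⟩ (by
        simpa [Nat.card_zpowers] using
          orderOf_injective (MulAut.conj g).toMonoidHom (MulAut.conj g).injective x)
  obtain ⟨k, rfl⟩ := Subgroup.mem_zpowers_iff.mp hn
  rw [← conj_zpow, ← key]
  exact Subgroup.zpow_mem_zpowers _ k

/-- If cyclic subgroups of `G` are determined by their order, elements of coprime orders commute. -/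
theorem commute_of_injective_card_of_coprime {G : Type*} [Group G]
    (hinj : Function.Injective fun H : {H : Subgroup G // IsCyclic H} => Nat.card H.1)
    {x y : G} (hxy : (orderOf x).Coprime (orderOf y)) : Commute x y := by
  refine Subgroup.commute_of_normal_of_disjoint (Subgroup.zpowers x) (Subgroup.zpowers y)
    (normal_zpowers_of_injective_card hinj x) (normal_zpowers_of_injective_card hinj y) ?_ x y
    (Subgroup.mem_zpowers x) (Subgroup.mem_zpowers y)
  apply Subgroup.disjoint_of_coprime_natCard
  simpa [Nat.card_zpowers] using hxy

theorem stmt_9 {G : Type*} [Group G] [Finite G]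
    (h : Nat.card {H : Subgroup G // IsCyclic H} = 4) :
    (Nat.card G).primeFactors.card ≤ 2 := by
  classical
  by_contra! hc
  obtain ⟨p, q, r, hp, hq, hr, hpq, hpr, hqr⟩ := Finset.two_lt_card_iff.mp hc
  have hex : ∀ n ∈ (Nat.card G).primeFactors, ∃ x : G, orderOf x = n := fun n hn =>
    haveI : Fact n.Prime := ⟨Nat.prime_of_mem_primeFactors hn⟩
    exists_prime_orderOf_dvd_card' n (Nat.dvd_of_mem_primeFactors hn)
  obtain ⟨x, hx⟩ := hex p hp
  obtain ⟨y, hy⟩ := hex q hq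
  obtain ⟨z, hz⟩ := hex r hr
  replace hp := Nat.prime_of_mem_primeFactors hp
  replace hq := Nat.prime_of_mem_primeFactors hq
  replace hr := Nat.prime_of_mem_primeFactors hr
  let f : {H : Subgroup G // IsCyclic H} → ℕ := fun H => Nat.card H.1
  have := Fintype.ofFinite {H : Subgroup G // IsCyclic H}
  have huniv : (Finset.univ : Finset {H : Subgroup G // IsCyclic H}).card = 4 := by
    rw [Finset.card_univ, ← Nat.card_eq_fintype_card, h]
  have hmem : ∀ g : G, orderOf g ∈ Finset.univ.image f := fun g =>
    Finset.mem_image.mpr ⟨⟨Subgroup.zpowers g, inferInstance⟩, Finset.mem_univ _,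
      Nat.card_zpowers g⟩
  have hsub : ({1, p, q, r} : Finset ℕ) ⊆ Finset.univ.image f := by
    simp only [Finset.insert_subset_iff, Finset.singleton_subset_iff]
    exact ⟨orderOf_one (G := G) ▸ hmem 1, hx ▸ hmem x, hy ▸ hmem y, hz ▸ hmem z⟩
  have hfour : ({1, p, q, r} : Finset ℕ).card = 4 := by
    simp [hpq, hpr, hqr, hp.ne_one.symm, hq.ne_one.symm, hr.ne_one.symm]
  have himage : ({1, p, q, r} : Finset ℕ) = Finset.univ.image f :=
    Finset.eq_of_subset_of_card_le hsub (by
      rw [hfour, ← huniv]; exact Finset.card_image_le)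
  have hinj : Function.Injective f := by
    rw [← Set.injOn_univ, ← Finset.coe_univ]
    exact Finset.injOn_of_card_image_eq (by rw [← himage, hfour, huniv])
  have hcop : (orderOf x).Coprime (orderOf y) := by
    rw [hx, hy]; exact (Nat.coprime_primes hp hq).mpr hpq
  have hxy := hmem (x * y)
  rw [(commute_of_injective_card_of_coprime hinj hcop).orderOf_mul_eq_mul_orderOf_of_coprime hcop,
    hx, hy, ← himage] at hxy
  simp only [Finset.mem_insert, Finset.mem_singleton] at hxy
  rcases hxy with h1 | h1 | h1 | h1
  · exact hp.ne_one (Nat.eq_one_of_mul_eq_one_right h1)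
  · exact hq.ne_one (Nat.mul_eq_left hp.ne_zero |>.mp h1)
  · exact hp.ne_one (Nat.mul_eq_right hq.ne_zero |>.mp h1)
  · exact Nat.not_prime_mul hp.ne_one hq.ne_one (h1 ▸ hr)
end

section
/- Let G be a finite group with exactly 3 cyclic subgroups. Then the order of G is a power of a single prime, i.e., G is a p-group for some prime p. -/
/-- A finite group that is not a `p`-group has order divisible by a prime other than `p`. -/
theorem exists_prime_ne_dvd_card_of_not_isPGroup {G : Type*} [Group G] [Finite G] {p : ℕ}
    (h : ¬ IsPGroup p G) : ∃ q : ℕ, q.Prime ∧ q ∣ Nat.card G ∧ q ≠ p := by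
  by_contra! hq
  exact h (IsPGroup.of_card
    (Nat.eq_prime_pow_of_unique_prime_dvd Nat.card_pos.ne' fun hd hdvd => hq _ hd hdvd))

/-- If neither of `x`, `y` is a power of the other, then `1`, `x`, `y` and `x * y` generate
distinct cyclic subgroups. -/
theorem four_le_card_cyclic_subgroups {G : Type*} [Group G] [Finite G] {x y : G}
    (hx : x ∉ Subgroup.zpowers y) (hy : y ∉ Subgroup.zpowers x) :
    4 ≤ Nat.card {H : Subgroup G // IsCyclic H} := by
  have hxy : x * y ∉ Subgroup.zpowers x := fun h =>
    hy ((Subgroup.mul_mem_cancel_left _ (Subgroup.mem_zpowers x)).1 h)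
  have hyx : x * y ∉ Subgroup.zpowers y := fun h =>
    hx ((Subgroup.mul_mem_cancel_right _ (Subgroup.mem_zpowers y)).1 h)
  have key : ∀ {a b : G}, a ∉ Subgroup.zpowers b →
      Subgroup.zpowers a ≠ Subgroup.zpowers b := fun {a b} hab h =>
    hab (h ▸ Subgroup.mem_zpowers a)
  have ne_one : ∀ {a b : G}, a ∉ Subgroup.zpowers b →
      Subgroup.zpowers a ≠ Subgroup.zpowers 1 := fun {a b} hab =>
    key fun h => hab (Subgroup.zpowers_le.2 (one_mem (Subgroup.zpowers b)) h)
  let c : G → {H : Subgroup G // IsCyclic H} := fun a => ⟨Subgroup.zpowers a, inferInstance⟩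
  have hc : ∀ {a b : G}, Subgroup.zpowers a ≠ Subgroup.zpowers b → c a ≠ c b :=
    fun hab h => hab (congrArg Subtype.val h)
  have hcard : ({c (x * y), c x, c y, c 1} : Set {H : Subgroup G // IsCyclic H}).ncard = 4 := by
    rw [Set.ncard_insert_of_notMem, Set.ncard_insert_of_notMem,
      Set.ncard_pair (hc (ne_one hy))]
    · simp only [Set.mem_insert_iff, Set.mem_singleton_iff, not_or]
      exact ⟨hc (key hx), hc (ne_one hx)⟩
    · simp only [Set.mem_insert_iff, Set.mem_singleton_iff, not_or]
      exact ⟨hc (key hxy), hc (key hyx), hc (ne_one hxy)⟩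
  exact hcard ▸ Set.ncard_le_card _

/-- Elements of distinct prime orders are not powers of one another. -/
theorem notMem_zpowers_of_orderOf_prime {G : Type*} [Group G] {x y : G}
    (hx : (orderOf x).Prime) (hy : (orderOf y).Prime) (hne : orderOf x ≠ orderOf y) :
    x ∉ Subgroup.zpowers y := fun h =>
  hne ((Nat.prime_dvd_prime_iff_eq hx hy).1 (orderOf_dvd_of_mem_zpowers h))

theorem stmt_10 {G : Type*} [Group G] [Finite G]
    (h : Nat.card {H : Subgroup G // IsCyclic H} = 3) :
    ∃ p : ℕ, p.Prime ∧ IsPGroup p G := by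
  by_contra! hG
  obtain ⟨p, hp, hpG, -⟩ := exists_prime_ne_dvd_card_of_not_isPGroup (hG 2 Nat.prime_two)
  obtain ⟨q, hq, hqG, hne⟩ := exists_prime_ne_dvd_card_of_not_isPGroup (hG p hp)
  have := Fact.mk hp
  have := Fact.mk hq
  obtain ⟨x, rfl⟩ := exists_prime_orderOf_dvd_card' p hpG
  obtain ⟨y, rfl⟩ := exists_prime_orderOf_dvd_card' q hqG
  have h4 := four_le_card_cyclic_subgroups (notMem_zpowers_of_orderOf_prime hp hq hne.symm)
    (notMem_zpowers_of_orderOf_prime hq hp hne)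
  omega
end

section
/- Let p and q be distinct primes and let b ≥ 2. Then no finite group of order p·q^b has exactly 5 cyclic subgroups. -/
open Subgroup in
/-- A list in which no element lies in the cyclic subgroup generated by an earlier one
bounds the number of cyclic subgroups from below. -/
theorem length_le_card_isCyclic_subgroup {G : Type*} [Group G] [Finite G] (L : List G)
    (hL : L.Pairwise fun a b => b ∉ zpowers a) :
    L.length ≤ Nat.card {H : Subgroup G // IsCyclic H} := by
  have hinj : Function.Injective fun i : Fin L.length =>
      (⟨zpowers (L.get i), inferInstance⟩ : {H : Subgroup G // IsCyclic H}) := by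
    have key : ∀ i j : Fin L.length, i < j → zpowers (L.get i) ≠ zpowers (L.get j) :=
      fun i j hij h => List.pairwise_iff_get.1 hL i j hij (h ▸ mem_zpowers _)
    intro i j h
    have h' : zpowers (L.get i) = zpowers (L.get j) := congrArg Subtype.val h
    rcases lt_trichotomy i j with hij | hij | hij
    · exact (key i j hij h').elim
    · exact hij
    · exact (key j i hij h'.symm).elim
  simpa using Nat.card_le_card_of_injective _ hinj

/-- A subgroup contained in neither of two subgroups is not contained in their union. -/
theorem Subgroup.exists_mem_notMem_notMem {G : Type*} [Group G] {K H₁ H₂ : Subgroup G}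
    (h₁ : ¬ K ≤ H₁) (h₂ : ¬ K ≤ H₂) : ∃ g ∈ K, g ∉ H₁ ∧ g ∉ H₂ := by
  obtain ⟨a, ha, ha₁⟩ := SetLike.not_le_iff_exists.1 h₁
  obtain ⟨c, hc, hc₂⟩ := SetLike.not_le_iff_exists.1 h₂
  by_cases ha₂ : a ∈ H₂
  · by_cases hc₁ : c ∈ H₁
    · refine ⟨a * c, K.mul_mem ha hc, ?_, ?_⟩
      · rwa [H₁.mul_mem_cancel_right hc₁]
      · rwa [H₂.mul_mem_cancel_left ha₂]
    · exact ⟨c, hc, hc₁, hc₂⟩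
  · exact ⟨a, ha, ha₁, ha₂⟩

theorem Sylow.not_le_of_ne {G : Type*} [Group G] {p : ℕ} {P Q : Sylow p G} (h : P ≠ Q) :
    ¬ (P : Subgroup G) ≤ Q := fun hle =>
  h (Sylow.ext (P.is_maximal' Q.isPGroup' hle).symm)

open Subgroup in
/-- A non-normal Sylow subgroup `P` misses two elements of other Sylow subgroups,
the second of which is not a power of the first. -/
theorem Sylow.exists_notMem_of_not_normal {G : Type*} [Group G] [Finite G] {p : ℕ}
    [Fact p.Prime] (P : Sylow p G) (hP : ¬ (P : Subgroup G).Normal) :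
    ∃ (P₁ P₂ : Sylow p G), ∃ v ∈ P₁, ∃ w ∈ P₂, v ∉ P ∧ w ∉ P ∧ w ∉ zpowers v := by
  have hns : ¬ Subsingleton (Sylow p G) := fun h => hP P.normal_of_subsingleton
  have h1 : 1 < Nat.card (Sylow p G) := by
    rw [not_subsingleton_iff_nontrivial] at hns
    exact Finite.one_lt_card
  have h2 : 2 < Nat.card (Sylow p G) := by
    refine lt_of_le_of_ne h1 fun h => ?_
    have hmod := card_sylow_modEq_one p G
    rw [← h] at hmod
    have := (Nat.modEq_iff_dvd' (by norm_num : 1 ≤ 2)).1 hmod.symm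
    exact (Fact.out : p.Prime).one_lt.ne' (Nat.dvd_one.1 this)
  classical
  have := Fintype.ofFinite (Sylow p G)
  rw [Nat.card_eq_fintype_card, ← Finset.card_univ] at h1 h2
  obtain ⟨P₁, -, h₁⟩ := Finset.exists_mem_ne h1 P
  obtain ⟨P₂, -, h₂⟩ := Finset.exists_mem_notMem_of_card_lt_card
    ((Finset.card_le_two (a := P) (b := P₁)).trans_lt h2)
  simp only [Finset.mem_insert, Finset.mem_singleton, not_or] at h₂
  obtain ⟨v, hv, hvP⟩ := SetLike.not_le_iff_exists.1 (Sylow.not_le_of_ne h₁)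
  obtain ⟨w, hw, hwP, hw₁⟩ := Subgroup.exists_mem_notMem_notMem
    (Sylow.not_le_of_ne h₂.1) (Sylow.not_le_of_ne h₂.2)
  exact ⟨P₁, P₂, v, hv, w, hw, hvP, hwP, fun h => hw₁ ((zpowers_le.2 hv) h)⟩

open Subgroup in
theorem Subgroup.exists_ne_one_notMem_zpowers {G : Type*} [Group G] [Finite G] {q : ℕ}
    [Fact q.Prime] (Q : Subgroup G) (hQ : q ^ 2 ∣ Nat.card Q) :
    ∃ x ∈ Q, ∃ y ∈ Q, x ≠ 1 ∧ y ∉ zpowers x := by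
  have hq : q.Prime := Fact.out
  obtain ⟨x, hx⟩ := exists_prime_orderOf_dvd_card' (G := Q) q
    ((dvd_pow_self q two_ne_zero).trans hQ)
  rw [← Subgroup.orderOf_coe] at hx
  have hlt : ¬ Q ≤ zpowers (x : G) := fun hle => by
    have h := Nat.le_of_dvd hq.pos (hQ.trans (hx ▸ Nat.card_zpowers (x : G) ▸ card_dvd_of_le hle))
    nlinarith [hq.two_le]
  obtain ⟨y, hy, hyx⟩ := SetLike.not_le_iff_exists.1 hlt
  refine ⟨x, x.2, y, hy, fun h => ?_, hyx⟩
  rw [h, orderOf_one] at hx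
  exact hq.one_lt.ne hx

open Subgroup in
/-- A finite group of order divisible by `p * q ^ 2`, with `p ≠ q` primes, has at least six
cyclic subgroups. -/
theorem six_le_card_isCyclic_subgroup {G : Type*} [Group G] [Finite G] {p q : ℕ}
    [Fact p.Prime] [Fact q.Prime] (hpq : p ≠ q) (hp : p ∣ Nat.card G)
    (hq : q ^ 2 ∣ Nat.card G) : 6 ≤ Nat.card {H : Subgroup G // IsCyclic H} := by
  obtain ⟨P⟩ : Nonempty (Sylow p G) := inferInstance
  obtain ⟨Q⟩ : Nonempty (Sylow q G) := inferInstance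
  have disj : ∀ (P : Sylow p G) (Q : Sylow q G), Disjoint (P : Subgroup G) Q := fun P Q =>
    IsPGroup.disjoint_of_ne p q hpq _ _ P.isPGroup' Q.isPGroup'
  have inter : ∀ {P : Sylow p G} {Q : Sylow q G} {g : G}, g ∈ P → g ∈ Q → g = 1 :=
    fun hgP hgQ => disjoint_def.1 (disj _ _) hgP hgQ
  have mem : ∀ {H : Subgroup G} {g h : G}, g ∈ H → h ∉ H → h ∉ zpowers g :=
    fun hg hh h => hh (zpowers_le.2 hg h)
  have hQ : q ^ 2 ∣ Nat.card Q := Q.pow_dvd_card_of_pow_dvd_card hq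
  obtain ⟨x, hx, y, hy, hx1, hyx⟩ := exists_ne_one_notMem_zpowers (Q : Subgroup G) hQ
  have hPbot : (P : Subgroup G) ≠ ⊥ := P.ne_bot_of_dvd_card hp
  obtain ⟨u, hu, hu1⟩ := (P : Subgroup G).bot_or_exists_ne_one.resolve_left hPbot
  have hy1 : y ≠ 1 := fun h => hyx (h ▸ one_mem _)
  by_cases hQn : (Q : Subgroup G).Normal
  · have huQ : u ∉ (Q : Subgroup G) := fun h => hu1 (inter hu h)
    by_cases hPn : (P : Subgroup G).Normal
    · have comm : ∀ z ∈ Q, Commute z u := fun z hz =>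
        commute_of_normal_of_disjoint _ _ hQn hPn (disj P Q).symm z u hz hu
      have hzQ : ∀ z ∈ Q, z * u ∉ (Q : Subgroup G) := fun z hz => by
        rwa [(Q : Subgroup G).mul_mem_cancel_left hz]
      have hzP : ∀ z ∈ Q, z ≠ 1 → z * u ∉ (P : Subgroup G) := fun z hz hz1 => by
        rw [(P : Subgroup G).mul_mem_cancel_right hu]
        exact fun h => hz1 (inter h hz)
      have hyxu : y * u ∉ zpowers (x * u) := by
        rintro ⟨k, hk : (x * u) ^ k = y * u⟩
        rw [(comm x hx).mul_zpow] at hk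
        have hk' : (x ^ k)⁻¹ * y = u ^ k * u⁻¹ := by
          rw [inv_mul_eq_iff_eq_mul, ← mul_assoc, hk, mul_inv_cancel_right]
        have hone : (x ^ k)⁻¹ * y = 1 := inter (P := P) (Q := Q)
          (hk' ▸ mul_mem (zpow_mem hu k) (inv_mem hu))
          (mul_mem (inv_mem (zpow_mem hx k)) hy)
        exact hyx ⟨k, inv_mul_eq_one.1 hone⟩
      refine length_le_card_isCyclic_subgroup [1, x, y, u, x * u, y * u] ?_
      have hxuQ := hzQ x hx
      have hyuQ := hzQ y hy
      have hxu1 : x * u ≠ 1 := fun h => hxuQ (h ▸ one_mem _)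
      have hyu1 : y * u ≠ 1 := fun h => hyuQ (h ▸ one_mem _)
      simp [hx1, hy1, hu1, hyx, hyxu, mem hx huQ, mem hy huQ, mem hx hxuQ, mem hy hxuQ,
        mem hx hyuQ, mem hy hyuQ, mem hu (hzP x hx hx1), mem hu (hzP y hy hy1),
        hxu1, hyu1]
    · obtain ⟨P₁, P₂, v, hv, w, hw, hvP, hwP, hwv⟩ := P.exists_notMem_of_not_normal hPn
      have hv1 : v ≠ 1 := fun h => hvP (h ▸ one_mem _)
      have hw1 : w ≠ 1 := fun h => hwP (h ▸ one_mem _)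
      have hvQ : v ∉ (Q : Subgroup G) := fun h => hv1 (inter hv h)
      have hwQ : w ∉ (Q : Subgroup G) := fun h => hw1 (inter hw h)
      refine length_le_card_isCyclic_subgroup [1, x, y, u, v, w] ?_
      simp [hx1, hy1, hu1, hv1, hw1, hyx, hwv, mem hx huQ, mem hy huQ, mem hx hvQ, mem hy hvQ,
        mem hx hwQ, mem hy hwQ, mem hu hvP, mem hu hwP]
  · obtain ⟨Q₁, Q₂, v, hv, w, hw, hvQ, hwQ, hwv⟩ := Q.exists_notMem_of_not_normal hQn
    have hv1 : v ≠ 1 := fun h => hvQ (h ▸ one_mem _)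
    have hw1 : w ≠ 1 := fun h => hwQ (h ▸ one_mem _)
    have hu' : ∀ (R : Sylow q G), ∀ z ∈ R, u ∉ zpowers z := fun R z hz h =>
      hu1 (inter hu (zpowers_le.2 hz h))
    refine length_le_card_isCyclic_subgroup [1, x, y, v, w, u] ?_
    simp [hx1, hy1, hu1, hv1, hw1, hyx, hwv, mem hx hvQ, mem hy hvQ, mem hx hwQ, mem hy hwQ,
      hu' Q x hx, hu' Q y hy, hu' Q₁ v hv, hu' Q₂ w hw]

theorem stmt_11 (p q : ℕ) (hp : p.Prime) (hq : q.Prime) (hpq : p ≠ q)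
    (b : ℕ) (hb : 2 ≤ b) (G : Type*) [Group G] [Finite G]
    (hG : Nat.card G = p * q ^ b) :
    Nat.card {H : Subgroup G // IsCyclic H} ≠ 5 := by
  have := Fact.mk hp
  have := Fact.mk hq
  have h := six_le_card_isCyclic_subgroup (G := G) hpq (hG ▸ dvd_mul_right p _)
    (hG ▸ (pow_dvd_pow q hb).mul_left p)
  omega
end

section
/- Let G be a finite group whose order is a product p·q of two distinct primes, and suppose G has exactly 5 cyclic subgroups. Then G is isomorphic to the symmetric group S_3. -/
lemma Sylow.card_of_card_eq_mul {G : Type*} [Group G] [Finite G] {p q : ℕ} (hp : p.Prime)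
    (hq : q.Prime) (hpq : p ≠ q) (hG : Nat.card G = p * q) (P : Sylow p G) :
    Nat.card P = p := by
  have := Fact.mk hp
  rw [P.card_eq_multiplicity, hG, Nat.factorization_mul hp.ne_zero hq.ne_zero]
  simp [hp.factorization_self, Nat.factorization_eq_zero_of_not_dvd
    (fun h => hpq ((Nat.prime_dvd_prime_iff_eq hp hq).1 h))]

lemma Sylow.exists_coe_eq_of_card {G : Type*} [Group G] [Finite G] {p q : ℕ} (hp : p.Prime)
    (hq : q.Prime) (hpq : p ≠ q) (hG : Nat.card G = p * q) {H : Subgroup G}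
    (hH : Nat.card H = p) : ∃ P : Sylow p G, (P : Subgroup G) = H := by
  have := Fact.mk hp
  obtain ⟨P, hP⟩ := (IsPGroup.of_card (n := 1) (by simpa using hH)).exists_le_sylow
  refine ⟨P, (Subgroup.eq_of_le_of_card_ge hP ?_).symm⟩
  rw [hH]
  exact (P.card_of_card_eq_mul hp hq hpq hG).le

lemma Sylow.card_sylow_eq_one_or_of_card_eq_mul {G : Type*} [Group G] [Finite G] {p q : ℕ}
    (hp : p.Prime) (hq : q.Prime) (hpq : p ≠ q) (hG : Nat.card G = p * q) :
    Nat.card (Sylow p G) = 1 ∨ Nat.card (Sylow p G) = q := by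
  have := Fact.mk hp
  have P : Sylow p G := default
  have hi : (P : Subgroup G).index = q := by
    have h := (P : Subgroup G).card_mul_index
    rw [P.card_of_card_eq_mul hp hq hpq hG, hG] at h
    exact Nat.eq_of_mul_eq_mul_left hp.pos h
  exact (Nat.dvd_prime hq).1 (hi ▸ P.card_dvd_index)

lemma Subgroup.eq_bot_or_eq_top_or_sylow_of_card_eq_mul {G : Type*} [Group G] [Finite G] {p q : ℕ}
    (hp : p.Prime) (hq : q.Prime) (hpq : p ≠ q) (hG : Nat.card G = p * q) (H : Subgroup G) :
    H = ⊥ ∨ H = ⊤ ∨ (∃ P : Sylow p G, (P : Subgroup G) = H) ∨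
      ∃ Q : Sylow q G, (Q : Subgroup G) = H := by
  have hd := H.card_subgroup_dvd_card
  rw [hG] at hd
  obtain ⟨a, b, ha, hb, hab⟩ := exists_dvd_and_dvd_of_dvd_mul hd
  rcases (Nat.dvd_prime hp).1 ha with rfl | rfl <;> rcases (Nat.dvd_prime hq).1 hb with rfl | rfl
  · exact Or.inl (Subgroup.eq_bot_of_card_eq H (by simpa using hab))
  · exact Or.inr (Or.inr (Or.inr (Sylow.exists_coe_eq_of_card hq hp hpq.symm
      (by rw [hG, mul_comm]) (by simpa using hab))))
  · exact Or.inr (Or.inr (Or.inl (Sylow.exists_coe_eq_of_card hp hq hpq hG (by simpa using hab))))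
  · exact Or.inr (Or.inl (Subgroup.eq_top_of_card_eq H (by rw [hab, hG])))

lemma card_cyclic_subgroups_of_not_isCyclic {G : Type*} [Group G] [Finite G] {p q : ℕ}
    (hp : p.Prime) (hq : q.Prime) (hpq : p ≠ q) (hG : Nat.card G = p * q) (hc : ¬ IsCyclic G) :
    Nat.card {H : Subgroup G // IsCyclic H} =
      1 + (Nat.card (Sylow p G) + Nat.card (Sylow q G)) := by
  have := Fact.mk hp
  have := Fact.mk hq
  have hP := Sylow.card_of_card_eq_mul hp hq hpq hG
  have hQ := Sylow.card_of_card_eq_mul hq hp hpq.symm (hG.trans (mul_comm p q))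
  let f : Unit ⊕ Sylow p G ⊕ Sylow q G → {H : Subgroup G // IsCyclic H} :=
    Sum.elim (fun _ => ⟨⊥, inferInstance⟩)
      (Sum.elim (fun P => ⟨P, isCyclic_of_prime_card (hP P)⟩)
        (fun Q => ⟨Q, isCyclic_of_prime_card (hQ Q)⟩))
  have hf : Function.Bijective f := by
    constructor
    · have hbP (P : Sylow p G) : (⊥ : Subgroup G) ≠ P := fun h => hp.one_lt.ne (by
        rw [← hP P, ← h, Subgroup.card_bot])
      have hbQ (Q : Sylow q G) : (⊥ : Subgroup G) ≠ Q := fun h => hq.one_lt.ne (by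
        rw [← hQ Q, ← h, Subgroup.card_bot])
      have hPQ (P : Sylow p G) (Q : Sylow q G) : (P : Subgroup G) ≠ Q := fun h => hpq (by
        rw [← hP P, ← hQ Q, h])
      rintro (_ | P | Q) (_ | P' | Q') h <;> have h := congrArg Subtype.val h
      · rfl
      · exact (hbP _ h).elim
      · exact (hbQ _ h).elim
      · exact (hbP _ h.symm).elim
      · exact congrArg _ (congrArg _ (Sylow.ext h))
      · exact (hPQ _ _ h).elim
      · exact (hbQ _ h.symm).elim
      · exact (hPQ _ _ h.symm).elim
      · exact congrArg _ (congrArg _ (Sylow.ext h))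
    · rintro ⟨H, hH⟩
      rcases H.eq_bot_or_eq_top_or_sylow_of_card_eq_mul hp hq hpq hG with
        rfl | rfl | ⟨P, rfl⟩ | ⟨Q, rfl⟩
      · exact ⟨Sum.inl (), rfl⟩
      · exact (hc (Subgroup.topEquiv.isCyclic.1 hH)).elim
      · exact ⟨Sum.inr (Sum.inl P), rfl⟩
      · exact ⟨Sum.inr (Sum.inr Q), rfl⟩
  rw [← Nat.card_congr (Equiv.ofBijective f hf), Nat.card_sum, Nat.card_sum, Nat.card_unique]

lemma card_subgroups_le_four_of_forall_normal {G : Type*} [Group G] [Finite G] {p q : ℕ}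
    (hp : p.Prime) (hq : q.Prime) (hpq : p ≠ q) (hG : Nat.card G = p * q)
    (hn : ∀ H : Subgroup G, H.Normal) :
    Nat.card (Subgroup G) ≤ 4 := by
  have := Fact.mk hp
  have := Fact.mk hq
  let P : Sylow p G := default
  let Q : Sylow q G := default
  have := Sylow.unique_of_normal P (hn _)
  have := Sylow.unique_of_normal Q (hn _)
  have h : (Set.univ : Set (Subgroup G)) ⊆ ({⊥, ⊤, (P : Subgroup G), (Q : Subgroup G)}) := by
    intro H _
    rcases H.eq_bot_or_eq_top_or_sylow_of_card_eq_mul hp hq hpq hG with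
      rfl | rfl | ⟨P', rfl⟩ | ⟨Q', rfl⟩
    · simp
    · simp
    · simp [Subsingleton.elim P' P]
    · simp [Subsingleton.elim Q' Q]
  rw [← Set.ncard_univ]
  refine (Set.ncard_le_ncard h (Set.toFinite _)).trans ?_
  have h₁ := Set.ncard_insert_le ⊥ ({⊤, (P : Subgroup G), (Q : Subgroup G)} : Set (Subgroup G))
  have h₂ := Set.ncard_insert_le ⊤ ({(P : Subgroup G), (Q : Subgroup G)} : Set (Subgroup G))
  have h₃ := Set.ncard_insert_le (P : Subgroup G) ({(Q : Subgroup G)} : Set (Subgroup G))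
  rw [Set.ncard_singleton] at h₃
  omega

lemma nonempty_mulEquiv_perm_of_card_eq_six {G : Type*} [Group G] [Finite G]
    (hG : Nat.card G = 6) (h : Nat.card (Sylow 2 G) ≠ 1) :
    Nonempty (G ≃* Equiv.Perm (Fin 3)) := by
  have : Fact (Nat.Prime 2) := ⟨Nat.prime_two⟩
  let P : Sylow 2 G := default
  have hP : Nat.card P = 2 :=
    P.card_of_card_eq_mul Nat.prime_two Nat.prime_three (by norm_num) hG
  have hn : ¬ (P : Subgroup G).Normal := fun hN => h (by
    have := Sylow.unique_of_normal P hN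
    exact Nat.card_unique)
  have hi : Nat.card (G ⧸ (P : Subgroup G)) = 3 := by
    have := (P : Subgroup G).card_mul_index
    rw [hP, hG] at this
    change (P : Subgroup G).index = 3
    omega
  have hk : (MulAction.toPermHom G (G ⧸ (P : Subgroup G))).ker = ⊥ := by
    rw [← Subgroup.normalCore_eq_ker]
    have hle := (P : Subgroup G).normalCore_le
    have hd := Subgroup.card_dvd_of_le hle
    rw [hP] at hd
    rcases (Nat.dvd_prime Nat.prime_two).1 hd with h1 | h2
    · exact Subgroup.eq_bot_of_card_eq _ h1
    · refine (hn ?_).elim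
      rw [← Subgroup.eq_of_le_of_card_ge hle (by rw [h2, hP])]
      infer_instance
  have hb : Function.Bijective (MulAction.toPermHom G (G ⧸ (P : Subgroup G))) := by
    rw [Nat.bijective_iff_injective_and_card]
    refine ⟨(MonoidHom.ker_eq_bot_iff _).1 hk, ?_⟩
    rw [hG, Nat.card_perm, hi]
    rfl
  exact ⟨(MulEquiv.ofBijective _ hb).trans (Finite.equivFinOfCardEq hi).permCongrHom⟩

theorem stmt_12 {G : Type*} [Group G] [Finite G]
    (p q : ℕ) (hp : p.Prime) (hq : q.Prime) (hpq : p ≠ q)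
    (hG : Nat.card G = p * q)
    (h : Nat.card {H : Subgroup G // IsCyclic H} = 5) :
    Nonempty (G ≃* Equiv.Perm (Fin 3)) := by
  have hc : ¬ IsCyclic G := by
    intro hc
    have h₁ := card_subgroups_le_four_of_forall_normal hp hq hpq hG
      (fun H => ⟨fun n hn g => by
        rwa [IsCyclic.isMulCommutative.is_comm.comm g n, mul_inv_cancel_right]⟩)
    have h₂ := Nat.card_le_card_of_injective
      (Subtype.val : {H : Subgroup G // IsCyclic H} → Subgroup G) Subtype.val_injective
    omega
  rw [card_cyclic_subgroups_of_not_isCyclic hp hq hpq hG hc] at h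
  have hq' := hG.trans (mul_comm p q)
  have := Fact.mk hp
  have := Fact.mk hq
  have mp := card_sylow_modEq_one p G
  have mq := card_sylow_modEq_one q G
  have p2 := hp.two_le
  have q2 := hq.two_le
  rcases Sylow.card_sylow_eq_one_or_of_card_eq_mul hp hq hpq hG with h₁ | h₁ <;>
    rcases Sylow.card_sylow_eq_one_or_of_card_eq_mul hq hp hpq.symm hq' with h₂ | h₂
  · omega
  · obtain rfl : p = 3 := by omega
    rw [h₂] at mq
    have hd : q ∣ 2 := (Nat.modEq_iff_dvd' (by norm_num)).1 mq.symm
    obtain rfl : q = 2 := (Nat.prime_dvd_prime_iff_eq hq Nat.prime_two).1 hd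
    exact nonempty_mulEquiv_perm_of_card_eq_six hG (by omega)
  · obtain rfl : q = 3 := by omega
    rw [h₁] at mp
    have hd : p ∣ 2 := (Nat.modEq_iff_dvd' (by norm_num)).1 mp.symm
    obtain rfl : p = 2 := (Nat.prime_dvd_prime_iff_eq hp Nat.prime_two).1 hd
    exact nonempty_mulEquiv_perm_of_card_eq_six hG (by omega)
  · omega
end

section
/- Let p ≥ 5 be a prime and let G be a finite p-group with exactly 5 cyclic subgroups. Then G is isomorphic to the cyclic group C_{p^4}. -/
/-- In a finite cyclic group, a subgroup consists of all elements killed by its order. -/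
theorem IsCyclic.mem_subgroup_iff_pow_card {G : Type*} [Group G] [Finite G] [IsCyclic G]
    (H : Subgroup G) (x : G) : x ∈ H ↔ x ^ Nat.card H = 1 := by
  classical
  have := Fintype.ofFinite G
  have hsub : (Finset.univ.filter (· ∈ H)) ⊆
      Finset.univ.filter (fun x : G => x ^ Nat.card H = 1) := by
    intro y hy
    simp only [Finset.mem_filter, Finset.mem_univ, true_and] at hy ⊢
    exact congrArg Subtype.val (pow_card_eq_one' (x := (⟨y, hy⟩ : H)))
  have hcard : (Finset.univ.filter (· ∈ H)).card = Nat.card H := by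
    rw [Nat.card_eq_fintype_card, Fintype.card_subtype]
  have heq := Finset.eq_of_subset_of_card_le hsub
    ((IsCyclic.card_pow_eq_one_le Nat.card_pos).trans hcard.ge)
  simpa using Finset.ext_iff.mp heq x

/-- The subgroups of a finite cyclic group correspond to the divisors of its order. -/
theorem IsCyclic.card_subgroup {G : Type*} [Group G] [Finite G] [IsCyclic G] :
    Nat.card (Subgroup G) = (Nat.card G).divisors.card := by
  obtain ⟨g, hg⟩ := IsCyclic.exists_generator (α := G)
  rw [← Nat.card_eq_finsetCard]
  refine Nat.card_eq_of_bijective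
    (fun H : Subgroup G => (⟨Nat.card H, Nat.mem_divisors.mpr
      ⟨H.card_subgroup_dvd_card, Nat.card_pos.ne'⟩⟩ : (Nat.card G).divisors)) ⟨?_, ?_⟩
  · intro H K hHK
    have hcard : Nat.card H = Nat.card K := congrArg Subtype.val hHK
    ext x
    rw [mem_subgroup_iff_pow_card, mem_subgroup_iff_pow_card, hcard]
  · rintro ⟨d, hd⟩
    obtain ⟨hd, -⟩ := Nat.mem_divisors.mp hd
    refine ⟨Subgroup.zpowers (g ^ (Nat.card G / d)), Subtype.ext ?_⟩
    have hdpos : 0 < d := Nat.pos_of_dvd_of_pos hd Nat.card_pos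
    have hne : Nat.card G / d ≠ 0 := (Nat.div_pos (Nat.le_of_dvd Nat.card_pos hd) hdpos).ne'
    change Nat.card (Subgroup.zpowers (g ^ (Nat.card G / d))) = d
    rw [Nat.card_zpowers, orderOf_pow_of_dvd hne, orderOf_eq_card_of_forall_mem_zpowers hg,
      Nat.div_div_self hd Nat.card_pos.ne']
    rw [orderOf_eq_card_of_forall_mem_zpowers hg]
    exact Nat.div_dvd_of_dvd hd

open scoped Pointwise in
/-- A finite `p`-group with at most `p` cyclic subgroups is cyclic. -/
theorem IsPGroup.isCyclic_of_card_isCyclic_le {G : Type*} [Group G] [Finite G] {p : ℕ}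
    (hp : p.Prime) (hpG : IsPGroup p G)
    (h : Nat.card {H : Subgroup G // IsCyclic H} ≤ p) : IsCyclic G := by
  classical
  have := Fintype.ofFinite {H : Subgroup G // IsCyclic H}
  have : Fact p.Prime := ⟨hp⟩
  by_contra hG
  have : Nontrivial G := Nontrivial.of_not_isCyclic hG
  let bot : {H : Subgroup G // IsCyclic H} := ⟨⊥, inferInstance⟩
  have hcover : ⋃ H ∈ Finset.univ.erase bot, (1 : G) • (H.1 : Set G) = Set.univ := by
    rw [Set.eq_univ_iff_forall]
    have hcov : ∀ x : G, x ≠ 1 →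
        x ∈ ⋃ H ∈ Finset.univ.erase bot, (1 : G) • (H.1 : Set G) := by
      intro x hx
      simp only [one_smul, Set.mem_iUnion]
      refine ⟨⟨Subgroup.zpowers x, inferInstance⟩, ?_, Subgroup.mem_zpowers x⟩
      simpa [bot] using hx
    intro x
    obtain rfl | hx := eq_or_ne x 1
    · obtain ⟨y, hy⟩ := exists_ne (1 : G)
      have hmem := hcov y hy
      simp only [one_smul, Set.mem_iUnion] at hmem ⊢
      obtain ⟨H, hH, -⟩ := hmem
      exact ⟨H, hH, H.1.one_mem⟩
    · exact hcov x hx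
  obtain ⟨H, -, -, hH⟩ := Subgroup.exists_index_le_card_of_leftCoset_cover hcover
  rw [Finset.card_erase_of_mem (Finset.mem_univ _), Finset.card_univ,
    ← Nat.card_eq_fintype_card] at hH
  obtain ⟨n, hn⟩ := hpG.index H.1
  have hlt : p ^ n < p ^ 1 := by
    have := hp.pos
    rw [← hn, pow_one]
    omega
  have hn0 : n = 0 := by
    have := (Nat.pow_lt_pow_iff_right hp.one_lt).mp hlt
    omega
  rw [hn0, pow_zero, Subgroup.index_eq_one] at hn
  have hcyc := H.2
  rw [hn] at hcyc
  exact hG (Subgroup.topEquiv.isCyclic.mp hcyc)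

theorem stmt_13 {G : Type*} [Group G] [Finite G]
    (p : ℕ) (hp : p.Prime) (hp5 : 5 ≤ p) (hpG : IsPGroup p G)
    (h : Nat.card {H : Subgroup G // IsCyclic H} = 5) :
    Nonempty (G ≃* Multiplicative (ZMod (p ^ 4))) := by
  have : Fact p.Prime := ⟨hp⟩
  have : IsCyclic G := hpG.isCyclic_of_card_isCyclic_le hp (h.trans_le hp5)
  obtain ⟨n, hn⟩ := IsPGroup.iff_card.mp hpG
  have hcount : Nat.card {H : Subgroup G // IsCyclic H} = Nat.card (Subgroup G) :=
    Nat.card_congr (Equiv.subtypeUnivEquiv fun H => H.isCyclic)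
  rw [h, IsCyclic.card_subgroup, hn, Nat.divisors_prime_pow hp, Finset.card_map,
    Finset.card_range] at hcount
  obtain rfl : n = 4 := by omega
  rw [← hn]
  exact ⟨(zmodCyclicMulEquiv inferInstance).symm⟩
end

section
/- Let G be a finite 3-group with exactly 5 cyclic subgroups. Then G is isomorphic to C_3 × C_3 or to the cyclic group C_{81}. -/
/-- The generators of a finite cyclic subgroup `H` are counted by Euler's totient function. -/
theorem Subgroup.natCard_generators {G : Type*} [Group G] [Finite G] (H : Subgroup G)
    [IsCyclic H] : Nat.card {g : G // Subgroup.zpowers g = H} = Nat.totient (Nat.card H) := by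
  classical
  have := Fintype.ofFinite H
  have key := IsCyclic.card_orderOf_eq_totient (α := H) (d := Fintype.card H) dvd_rfl
  rw [Nat.card_eq_fintype_card (α := H), ← key, ← Fintype.card_subtype, ← Nat.card_eq_fintype_card]
  refine Nat.card_congr
    { toFun := fun g => ⟨⟨g.1, Subgroup.zpowers_le.mp g.2.le⟩, ?_⟩
      invFun := fun x => ⟨x.1.1, ?_⟩
      left_inv := fun _ => rfl
      right_inv := fun _ => rfl }
  · rw [Subgroup.orderOf_mk, ← Nat.card_zpowers, g.2, Nat.card_eq_fintype_card]
  · apply Subgroup.eq_of_le_of_card_ge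
    · rw [Subgroup.zpowers_le]
      exact x.1.2
    · rw [Nat.card_zpowers, Subgroup.orderOf_coe, x.2, Nat.card_eq_fintype_card]

/-- A finite group is partitioned by the generator sets of its cyclic subgroups. -/
theorem Group.natCard_eq_sum_totient (G : Type*) [Group G] [Finite G]
    [Fintype {H : Subgroup G // IsCyclic H}] :
    Nat.card G = ∑ H : {H : Subgroup G // IsCyclic H}, Nat.totient (Nat.card H.1) := by
  let f : G → {H : Subgroup G // IsCyclic H} :=
    fun g => ⟨Subgroup.zpowers g, inferInstance⟩
  rw [← Nat.card_congr (Equiv.sigmaFiberEquiv f), Nat.card_sigma]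
  refine Finset.sum_congr rfl fun H _ => ?_
  have := H.2
  rw [← Subgroup.natCard_generators H.1]
  exact Nat.card_congr (Equiv.subtypeEquivRight fun g => Subtype.ext_iff)

theorem eq_zero_of_one_add_two_mul_three_pow {a n : ℕ} (h : 1 + 2 * 3 ^ a = 3 ^ n) : a = 0 := by
  rcases a with _ | a
  · rfl
  · have := Nat.pow_pos (n := a) (show 0 < 3 by norm_num)
    rcases n with _ | n <;> simp only [pow_succ, pow_zero] at h <;> omega

theorem one_add_two_mul_sum_two_three_pow {a b n : ℕ} (h : 1 + 2 * (3 ^ a + 3 ^ b) = 3 ^ n) :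
    n = 2 ∧ (a = 1 ∨ b = 1) := by
  rcases n with _ | n
  · simp at h
  rcases a with _ | a <;> rcases b with _ | b <;> simp only [pow_succ, pow_zero] at h
  · omega
  · have h' : 1 + 2 * 3 ^ b = 3 ^ n := by omega
    obtain rfl := eq_zero_of_one_add_two_mul_three_pow h'
    exact ⟨by rw [Nat.pow_right_injective (Nat.le_succ 2) (show 3 ^ n = 3 ^ 1 by omega)], by simp⟩
  · have h' : 1 + 2 * 3 ^ a = 3 ^ n := by omega
    obtain rfl := eq_zero_of_one_add_two_mul_three_pow h'
    exact ⟨by rw [Nat.pow_right_injective (Nat.le_succ 2) (show 3 ^ n = 3 ^ 1 by omega)], by simp⟩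
  · omega

theorem one_add_two_mul_sum_three_three_pow {a b c n : ℕ}
    (h : 1 + 2 * (3 ^ a + 3 ^ b + 3 ^ c) = 3 ^ n) :
    n = 3 ∧ (a = 2 ∨ b = 2 ∨ c = 2) := by
  rcases n with _ | n
  · simp at h
  rcases a with _ | a <;> rcases b with _ | b <;> rcases c with _ | c <;>
    simp only [pow_succ, pow_zero] at h <;> try omega
  · have := one_add_two_mul_sum_two_three_pow (a := b) (b := c) (n := n) (by omega)
    omega
  · have := one_add_two_mul_sum_two_three_pow (a := a) (b := c) (n := n) (by omega)
    omega
  · have := one_add_two_mul_sum_two_three_pow (a := a) (b := b) (n := n) (by omega)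
    omega

theorem one_add_two_mul_sum_four_three_pow {a b c d n : ℕ}
    (h : 1 + 2 * (3 ^ a + 3 ^ b + 3 ^ c + 3 ^ d) = 3 ^ n) :
    (n = 2 ∧ a = 0 ∧ b = 0 ∧ c = 0 ∧ d = 0) ∨
      (n = 4 ∧ (a = 3 ∨ b = 3 ∨ c = 3 ∨ d = 3)) := by
  rcases n with _ | n
  · simp at h
  rcases a with _ | a <;> rcases b with _ | b <;> rcases c with _ | c <;> rcases d with _ | d <;>
    simp only [pow_succ, pow_zero] at h <;> try omega
  · have := Nat.pow_right_injective (Nat.le_succ 2) (show 3 ^ n = 3 ^ 1 by omega)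
    omega
  · have := one_add_two_mul_sum_three_three_pow (a := b) (b := c) (c := d) (n := n) (by omega)
    omega
  · have := one_add_two_mul_sum_three_three_pow (a := a) (b := c) (c := d) (n := n) (by omega)
    omega
  · have := one_add_two_mul_sum_three_three_pow (a := a) (b := b) (c := d) (n := n) (by omega)
    omega
  · have := one_add_two_mul_sum_three_three_pow (a := a) (b := b) (c := c) (n := n) (by omega)
    omega

/-- A group of order `p ^ 2` and exponent dividing `p` is elementary abelian of rank two. -/
theorem Group.nonempty_mulEquiv_zmod_prod_zmod {p : ℕ} [Fact p.Prime] {G : Type*} [Group G]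
    (hcard : Nat.card G = p ^ 2) (hexp : ∀ g : G, g ^ p = 1) :
    Nonempty (G ≃* (Multiplicative (ZMod p) × Multiplicative (ZMod p))) := by
  have hp : p.Prime := Fact.out
  have : Finite G := Nat.finite_of_card_ne_zero (by rw [hcard]; exact pow_ne_zero 2 hp.ne_zero)
  let : CommGroup G := IsPGroup.commGroupOfCardEqPrimeSq hcard
  let : Module (ZMod p) (Additive G) := AddCommGroup.zmodModule (n := p) fun g => hexp g.toMul
  have : Module.Finite (ZMod p) (Additive G) := Module.Finite.of_finite
  have hrank : Module.finrank (ZMod p) (Additive G) = 2 := by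
    have h := Module.natCard_eq_pow_finrank (K := ZMod p) (V := Additive G)
    rw [Nat.card_zmod] at h
    exact (Nat.pow_right_injective hp.two_le (hcard.symm.trans h)).symm
  obtain ⟨e⟩ := FiniteDimensional.nonempty_linearEquiv_of_finrank_eq
    (R := ZMod p) (M := Additive G) (M' := ZMod p × ZMod p) (by simp [hrank])
  exact ⟨(AddEquiv.toMultiplicativeRight e.toAddEquiv).trans (MulEquiv.prodMultiplicative _ _)⟩

theorem stmt_14 {G : Type*} [Group G] [Finite G]
    (hpG : IsPGroup 3 G)
    (h : Nat.card {H : Subgroup G // IsCyclic H} = 5) :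
    Nonempty (G ≃* (Multiplicative (ZMod 3) × Multiplicative (ZMod 3))) ∨
    Nonempty (G ≃* Multiplicative (ZMod 81)) := by
  classical
  have : Fact (Nat.Prime 3) := ⟨Nat.prime_three⟩
  have := Fintype.ofFinite {H : Subgroup G // IsCyclic H}
  obtain ⟨n, hn⟩ := IsPGroup.iff_card.mp hpG
  let B : {H : Subgroup G // IsCyclic H} := ⟨⊥, inferInstance⟩
  have hexp : ∀ H : {H : {H : Subgroup G // IsCyclic H} // H ≠ B},
      ∃ k, Nat.card H.1.1 = 3 ^ (k + 1) := by
    intro H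
    obtain ⟨_ | k, hk⟩ := IsPGroup.iff_card.mp (hpG.to_subgroup H.1.1)
    · exact absurd (Subtype.ext (Subgroup.card_eq_one.mp hk)) H.2
    · exact ⟨k, hk⟩
  choose k hk using hexp
  have hcard : Fintype.card {H : {H : Subgroup G // IsCyclic H} // H ≠ B} = 4 := by
    rw [Fintype.card_subtype_compl, Fintype.card_subtype_eq, ← Nat.card_eq_fintype_card, h]
  let e := Fintype.equivFinOfCardEq hcard
  have hsum : 1 + 2 * (3 ^ k (e.symm 0) + 3 ^ k (e.symm 1) + 3 ^ k (e.symm 2) +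
      3 ^ k (e.symm 3)) = 3 ^ n := by
    rw [← hn, Group.natCard_eq_sum_totient G, Fintype.sum_eq_add_sum_subtype_ne _ B,
      ← e.symm.sum_comp, Fin.sum_univ_four]
    simp only [hk, Nat.totient_prime_pow_succ Nat.prime_three]
    simp only [B, Subgroup.card_bot, Nat.totient_one]
    ring
  rcases one_add_two_mul_sum_four_three_pow hsum with ⟨rfl, h0, h1, h2, h3⟩ | ⟨rfl, hmax⟩
  · left
    refine Group.nonempty_mulEquiv_zmod_prod_zmod hn fun g => ?_
    rw [← orderOf_dvd_iff_pow_eq_one, ← Nat.card_zpowers]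
    by_cases hg : (⟨Subgroup.zpowers g, inferInstance⟩ : {H : Subgroup G // IsCyclic H}) = B
    · have : Subgroup.zpowers g = ⊥ := congrArg Subtype.val hg
      simp [this]
    · have hz : ∀ i, k (e.symm i) = 0 := by
        intro i
        fin_cases i <;> assumption
      have hgk := hk ⟨_, hg⟩
      have hg0 := hz (e ⟨_, hg⟩)
      rw [Equiv.symm_apply_apply] at hg0
      rw [hg0] at hgk
      exact hgk.dvd
  · right
    have hmax' : ∃ H, k H = 3 := by
      rcases hmax with h | h | h | h <;> exact ⟨_, h⟩
    obtain ⟨H, hH⟩ := hmax'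
    have htop : H.1.1 = ⊤ := Subgroup.eq_top_of_card_eq _ (by rw [hk, hH, hn])
    have hcyc : IsCyclic (⊤ : Subgroup G) := htop ▸ H.1.2
    have : IsCyclic G := isCyclic_of_surjective (Subgroup.topEquiv (G := G))
      Subgroup.topEquiv.surjective
    exact ⟨mulEquivOfCyclicCardEq (by simp [hn])⟩
end
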